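/- arXiv:0809.3937 — 9 statements merged into one kernel-verified Lean document; each statement's English description precedes it below -/
import Mathlib

section
/- Let I ⊂ ℝ be a compact interval, f = (f₁,…,f_n) : I → ℝⁿ a C^(n) map with f₁(x) = x whose Wronskian is nonzero for every x ∈ I, and λ ∈ C²(I). Let δ > 0, set C₁ := δ^{1/(n+1)}, and let Φ(C₁Q,δ) be the set of x ∈ I for which |F(x)| < δ(C₁Q)^{−n} for some F ∈ F_n(C₁Q). Then there exist constants C₃, C₄, C₇ > 0 (independent of Q) such that for all sufficiently large Q and every ξ ∈ I \ Φ(C₁Q,δ) there exists F ∈ F_n(C₇Q) satisfying |F(ξ)+λ(ξ)| ≤ C₃Q^{−n} and Q ≤ |F'(ξ)+λ'(ξ)| ≤ C₄Q. -/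
open MeasureTheory Filter Set

open Module in
/-- **Minkowski's linear forms theorem**, with strict inequalities. -/
theorem exists_int_ne_zero_forall_abs_mulVec_lt {ι : Type*} [Fintype ι] [DecidableEq ι]
    (A : Matrix ι ι ℝ) (hA : A.det ≠ 0) (r : ι → ℝ) (hr : ∀ i, 0 < r i)
    (h : |A.det| < ∏ i, r i) :
    ∃ z : ι → ℤ, z ≠ 0 ∧ ∀ i, |A.mulVec (fun j => (z j : ℝ)) i| < r i := by
  set b := Pi.basisFun ℝ ι with hb
  have hF : volume (ZSpan.fundamentalDomain b) = 1 := by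
    simp [hb, ZSpan.fundamentalDomain_pi_basisFun, volume_pi, Measure.pi_pi]
  set B : Set (ι → ℝ) := Set.pi univ fun i => Ioo (-r i) (r i) with hB
  set s : Set (ι → ℝ) := Matrix.toLin' A ⁻¹' B with hs
  have hdet : LinearMap.det (Matrix.toLin' A) = A.det := LinearMap.det_toLin' A
  have hmem : ∀ x, x ∈ s ↔ ∀ i, |A.mulVec x i| < r i := by
    intro x
    simp [hs, hB, abs_lt]
  have hvol : volume s = ENNReal.ofReal (|A.det|⁻¹ * ∏ i, (2 * r i)) := by
    rw [hs, Measure.addHaar_preimage_linearMap volume (by rwa [hdet]), hdet, hB,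
      Real.volume_pi_Ioo, ENNReal.ofReal_mul (by positivity), abs_inv,
      ENNReal.ofReal_prod_of_nonneg fun i _ => by have := hr i; positivity]
    simp only [sub_neg_eq_add, two_mul]
  have hlt : volume (ZSpan.fundamentalDomain b) * 2 ^ finrank ℝ (ι → ℝ) < volume s := by
    rw [hF, one_mul, hvol, finrank_fintype_fun_eq_card, Finset.prod_mul_distrib,
      Finset.prod_const, Finset.card_univ, ← ENNReal.ofReal_ofNat 2,
      ← ENNReal.ofReal_pow (by norm_num)]
    have hpos : 0 < |A.det| := abs_pos.2 hA
    refine (ENNReal.ofReal_lt_ofReal_iff ?_).2 ?_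
    · have := Finset.prod_pos fun i (_ : i ∈ Finset.univ) => hr i
      positivity
    · rw [← div_eq_inv_mul, lt_div_iff₀ hpos]
      gcongr
  have : Countable (Submodule.span ℤ (Set.range b)).toAddSubgroup := by
    change Countable (Submodule.span ℤ (Set.range b))
    infer_instance
  have hconv : Convex ℝ s := (convex_pi fun i _ => convex_Ioo _ _).linear_preimage _
  obtain ⟨⟨x, hx⟩, hne, hxs⟩ := exists_ne_zero_mem_lattice_of_measure_mul_two_pow_lt_measure
    (ZSpan.isAddFundamentalDomain' b volume)
    (fun x hx => by simpa [hmem, Matrix.mulVec_neg] using hx) hconv hlt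
  have hxz : ∀ i, ∃ z : ℤ, (z : ℝ) = x i := by
    intro i
    simpa [hb] using (b.mem_span_iff_repr_mem ℤ x).1 hx i
  choose z hz using hxz
  obtain rfl : (fun i => (z i : ℝ)) = x := funext hz
  refine ⟨z, ?_, (hmem _).1 hxs⟩
  rintro rfl
  exact hne (by ext; simp)

/-- Minkowski's linear forms theorem applied to a simultaneous inhomogeneous approximation
problem with a common multiplier `q` of the inhomogeneous part. -/
theorem exists_int_ne_zero_abs_linearForm_sub_mul_lt {n : ℕ} (y : Fin n → ℝ) (t₀ : ℝ)
    (t : Fin n → ℝ) {ε H : ℝ} (hε : 0 < ε) (hH : 0 < H) (N : ℕ)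
    (h : 1 < ε * H ^ n * (N + 1)) :
    ∃ q c₀ : ℤ, ∃ c : Fin n → ℤ, ¬(q = 0 ∧ c₀ = 0 ∧ c = 0) ∧ |q| ≤ N ∧
      |(c₀ : ℝ) + ∑ i, (c i : ℝ) * y i - q * t₀| < ε ∧
      ∀ i, |(c i : ℝ) - q * t i| < H := by
  let A : Matrix ((Fin n ⊕ Unit) ⊕ Unit) ((Fin n ⊕ Unit) ⊕ Unit) ℝ :=
    Matrix.fromBlocks (Matrix.fromBlocks 1 0 (Matrix.of fun _ i => y i) 1)
      (Matrix.of fun i _ => Sum.elim (fun i => -t i) (fun _ => -t₀) i) 0 1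
  let r : (Fin n ⊕ Unit) ⊕ Unit → ℝ :=
    Sum.elim (Sum.elim (fun _ => H) fun _ => ε) fun _ => N + 1
  have hA : A.det = 1 := by
    simp [A]
  obtain ⟨z, hz, hlt⟩ := exists_int_ne_zero_forall_abs_mulVec_lt A (by simp [hA]) r
    (by rintro ((i | i) | i) <;> simp [r] <;> positivity)
    (by simpa [hA, r, mul_comm ε] using h)
  refine ⟨z (.inr ()), z (.inl (.inr ())), fun i => z (.inl (.inl i)), ?_, ?_, ?_, fun i => ?_⟩
  · rintro ⟨h1, h2, h3⟩
    refine hz (funext ?_)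
    rintro ((i | i) | i)
    · exact congrFun h3 i
    · exact h2
    · exact h1
  · have := hlt (.inr ())
    simp [A, r, Matrix.mulVec, dotProduct] at this
    exact Int.lt_add_one_iff.1 (by exact_mod_cast this)
  · have := hlt (.inl (.inr ()))
    simp [A, r, Matrix.mulVec, dotProduct] at this
    convert this using 2
    simp only [mul_comm (y _)]
    ring
  · have := hlt (.inl (.inl i))
    simp [A, r, Matrix.mulVec, dotProduct, Matrix.one_apply] at this
    convert this using 2
    ring

/-- Transference: if the homogeneous system `|c₀ + ∑ cᵢ yᵢ| < ε`, `|cᵢ| < H` has no nonzero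
integer solution, then every inhomogeneous system with the bounds multiplied by `N !` is solvable
in integers, where `N` depends only on a lower bound for the volume. -/
theorem exists_int_abs_linearForm_sub_le_of_forall_homogeneous {n : ℕ} (y : Fin n → ℝ)
    {ε H : ℝ} (hε : 0 < ε) (hH : 0 < H) (N : ℕ) (h : 1 < ε * H ^ n * (N + 1))
    (hom : ∀ (c₀ : ℤ) (c : Fin n → ℤ), |(c₀ : ℝ) + ∑ i, (c i : ℝ) * y i| < ε →
      (∀ i, |(c i : ℝ)| < H) → c₀ = 0 ∧ c = 0) (t₀ : ℝ) (t : Fin n → ℝ) :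
    ∃ (c₀ : ℤ) (c : Fin n → ℤ), |(c₀ : ℝ) + ∑ i, (c i : ℝ) * y i - t₀| ≤ N.factorial * ε ∧
      ∀ i, |(c i : ℝ) - t i| ≤ N.factorial * H := by
  have hN : (N.factorial : ℝ) ≠ 0 := by positivity
  obtain ⟨q, c₀, c, hne, hq, h₀, hc⟩ := exists_int_ne_zero_abs_linearForm_sub_mul_lt y
    (t₀ / N.factorial) (fun i => t i / N.factorial) hε hH N h
  have hq0 : q ≠ 0 := by
    rintro rfl
    exact hne ⟨rfl, hom c₀ c (by simpa using h₀) (by simpa using hc)⟩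
  obtain ⟨m, hm⟩ : q ∣ (N.factorial : ℤ) := by
    rw [← Int.natAbs_dvd, Int.natCast_dvd_natCast]
    exact Nat.dvd_factorial (Int.natAbs_pos.2 hq0)
      (by rw [Int.abs_eq_natAbs] at hq; omega)
  have hm' : (N.factorial : ℝ) = q * m := by exact_mod_cast hm
  have hmle : |(m : ℝ)| ≤ N.factorial := by
    rw [← abs_of_nonneg (Nat.cast_nonneg (α := ℝ) N.factorial), hm', abs_mul]
    exact le_mul_of_one_le_left (abs_nonneg _) (by exact_mod_cast Int.one_le_abs hq0)
  have hcancel : ∀ u : ℝ, (m : ℝ) * (q * (u / N.factorial)) = u := by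
    intro u
    rw [← mul_assoc, mul_comm (m : ℝ), ← hm', mul_div_cancel₀ _ hN]
  refine ⟨m * c₀, fun i => m * c i, ?_, fun i => ?_⟩
  · calc _ = |(m : ℝ) * (c₀ + ∑ i, (c i : ℝ) * y i - q * (t₀ / N.factorial))| := by
          rw [mul_sub, hcancel, mul_add, Finset.mul_sum]
          push_cast
          simp only [mul_assoc]
      _ ≤ _ := by
          rw [abs_mul]
          gcongr
  · calc _ = |(m : ℝ) * (c i - q * (t i / N.factorial))| := by
          rw [mul_sub, hcancel]
          push_cast
          rfl
      _ ≤ _ := by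
          rw [abs_mul]
          gcongr
          exact (hc i).le

theorem stmt_8 (n : ℕ) (hn : 1 ≤ n) (a b : ℝ) (hab : a < b)
    (f : Fin n → ℝ → ℝ) (hf : ∀ i, ContDiffOn ℝ n (f i) (Icc a b))
    (hf1 : ∀ x, f ⟨0, by omega⟩ x = x)
    (hW : ∀ x ∈ Icc a b,
      (Matrix.of fun i j : Fin n =>
        iteratedDerivWithin ((j : ℕ) + 1) (f i) (Icc a b) x).det ≠ 0)
    (lam : ℝ → ℝ) (hlam : ContDiffOn ℝ 2 lam (Icc a b))
    (δ : ℝ) (hδ : 0 < δ) (C₁ : ℝ) (hC₁ : C₁ = δ ^ ((1 : ℝ) / ((n : ℝ) + 1))) :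
    ∃ C₃ C₄ C₇ : ℝ, 0 < C₃ ∧ 0 < C₄ ∧ 0 < C₇ ∧ ∃ Q₀ : ℝ, 0 < Q₀ ∧
      ∀ Q : ℝ, Q₀ < Q → ∀ ξ ∈ Icc a b,
        -- ξ ∉ Φ(C₁Q, δ):
        (¬ ∃ c₀ : ℤ, ∃ c : Fin n → ℤ, ¬(c₀ = 0 ∧ c = 0) ∧
            ((Finset.univ.sup fun i => (c i).natAbs : ℕ) : ℝ) ≤ C₁ * Q ∧
            |(c₀ : ℝ) + ∑ i, (c i : ℝ) * f i ξ| < δ * (C₁ * Q) ^ (-(n : ℤ))) →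
        ∃ c₀ : ℤ, ∃ c : Fin n → ℤ, ¬(c₀ = 0 ∧ c = 0) ∧
          ((Finset.univ.sup fun i => (c i).natAbs : ℕ) : ℝ) ≤ C₇ * Q ∧
          |(c₀ : ℝ) + (∑ i, (c i : ℝ) * f i ξ) + lam ξ| ≤ C₃ * Q ^ (-(n : ℤ)) ∧
          Q ≤ |(∑ i, (c i : ℝ) * derivWithin (f i) (Icc a b) ξ) +
                derivWithin lam (Icc a b) ξ| ∧
          |(∑ i, (c i : ℝ) * derivWithin (f i) (Icc a b) ξ) +
              derivWithin lam (Icc a b) ξ| ≤ C₄ * Q := by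
  obtain ⟨M, hM⟩ : ∃ M : ℝ, ∀ i, ∀ x ∈ Icc a b, |derivWithin (f i) (Icc a b) x| ≤ M := by
    have hbd : ∀ i, ∃ M : ℝ, ∀ x ∈ Icc a b, ‖derivWithin (f i) (Icc a b) x‖ ≤ M := fun i =>
      isCompact_Icc.exists_bound_of_continuousOn
        ((hf i).continuousOn_derivWithin (uniqueDiffOn_Icc hab) (by exact_mod_cast hn))
    choose M hM using hbd
    exact ⟨∑ i, |M i|, fun i x hx => (hM i x hx).trans <| (le_abs_self _).trans <|
      Finset.single_le_sum (f := fun i => |M i|) (fun _ _ => abs_nonneg _) (Finset.mem_univ i)⟩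
  obtain ⟨L, hL⟩ : ∃ L : ℝ, ∀ x ∈ Icc a b, ‖derivWithin lam (Icc a b) x‖ ≤ L :=
    isCompact_Icc.exists_bound_of_continuousOn
      (hlam.continuousOn_derivWithin (uniqueDiffOn_Icc hab) (by norm_num))
  set i₀ : Fin n := ⟨0, by omega⟩ with hi₀
  have hd1 : ∀ x ∈ Icc a b, derivWithin (f i₀) (Icc a b) x = 1 := by
    intro x hx
    have hid : f i₀ = id := funext hf1
    rw [hid]
    exact derivWithin_id x _ (uniqueDiffOn_Icc hab x hx)
  have hM0 : 0 ≤ M := (abs_nonneg _).trans (hM i₀ a (left_mem_Icc.2 hab.le))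
  have hL0 : 0 ≤ L := (norm_nonneg _).trans (hL a (left_mem_Icc.2 hab.le))
  have hC₁0 : 0 < C₁ := hC₁ ▸ Real.rpow_pos_of_pos hδ _
  obtain ⟨N, hN⟩ := exists_nat_gt (1 / δ)
  have hN1 : 1 < δ * (N + 1) := by
    rw [div_lt_iff₀ hδ] at hN
    linarith
  set K : ℝ := N.factorial * C₁ with hK
  have hK0 : 0 < K := by positivity
  set T : ℝ := n * (K * M) + 2 with hT
  have hT0 : 0 < T := by positivity
  refine ⟨N.factorial * (δ * C₁ ^ (-(n : ℤ))), 2 * T, K + T, by positivity, by positivity,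
    by positivity, L + 1, by positivity, fun Q hQ ξ hξ hhom => ?_⟩
  have hQ0 : 0 < Q := by linarith
  have hCQ : 0 < C₁ * Q := by positivity
  have hε : 0 < δ * (C₁ * Q) ^ (-(n : ℤ)) := by positivity
  obtain ⟨c₀, c, h₀, hc⟩ := exists_int_abs_linearForm_sub_le_of_forall_homogeneous
    (fun i => f i ξ) hε hCQ N
    (by rwa [mul_assoc δ, zpow_neg, zpow_natCast, inv_mul_cancel₀ (by positivity), mul_one])
    (fun c₀ c h₁ h₂ => by
      by_contra hne
      refine hhom ⟨c₀, c, hne, ?_, h₁⟩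
      obtain ⟨j, -, hj⟩ := Finset.exists_mem_eq_sup Finset.univ ⟨i₀, Finset.mem_univ _⟩
        (fun i => (c i).natAbs)
      rw [hj, Nat.cast_natAbs, Int.cast_abs]
      exact (h₂ j).le)
    (-lam ξ) (Pi.single i₀ (T * Q))
  have hKQ : (N.factorial : ℝ) * (C₁ * Q) = K * Q := by rw [hK]; ring
  rw [hKQ] at hc
  have hderiv : |(∑ i, (c i : ℝ) * derivWithin (f i) (Icc a b) ξ) - T * Q| ≤
      n * (K * Q * M) := by
    have hsingle : T * Q = ∑ i, (Pi.single i₀ (T * Q) : Fin n → ℝ) i *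
        derivWithin (f i) (Icc a b) ξ := by
      simp [Pi.single_apply, hd1 ξ hξ]
    rw [hsingle, ← Finset.sum_sub_distrib]
    calc _ ≤ ∑ i : Fin n, |(c i : ℝ) * derivWithin (f i) (Icc a b) ξ -
          (Pi.single i₀ (T * Q) : Fin n → ℝ) i * derivWithin (f i) (Icc a b) ξ| :=
          Finset.abs_sum_le_sum_abs _ _
      _ ≤ ∑ _i : Fin n, K * Q * M := by
          refine Finset.sum_le_sum fun i _ => ?_
          rw [← sub_mul, abs_mul]
          exact mul_le_mul (hc i) (hM i ξ hξ) (abs_nonneg _) (by positivity)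
      _ = _ := by simp
  have hl : |derivWithin lam (Icc a b) ξ| ≤ L := hL ξ hξ
  rw [abs_le] at hderiv hl
  have hTQ : T * Q = n * (K * Q * M) + 2 * Q := by rw [hT]; ring
  have hlow : Q ≤ (∑ i, (c i : ℝ) * derivWithin (f i) (Icc a b) ξ) +
      derivWithin lam (Icc a b) ξ := by linarith
  refine ⟨c₀, c, ?_, ?_, ?_, hlow.trans (le_abs_self _), ?_⟩
  · rintro ⟨-, rfl⟩
    simp at hlow
    linarith
  · obtain ⟨j, -, hj⟩ := Finset.exists_mem_eq_sup Finset.univ ⟨i₀, Finset.mem_univ _⟩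
      (fun i => (c i).natAbs)
    rw [hj, Nat.cast_natAbs, Int.cast_abs]
    have hs : |(Pi.single i₀ (T * Q) : Fin n → ℝ) j| ≤ T * Q := by
      rw [Pi.single_apply]
      split_ifs
      · rw [abs_of_pos (by positivity)]
      · simp only [abs_zero]
        positivity
    calc |(c j : ℝ)| ≤ |(c j : ℝ) - (Pi.single i₀ (T * Q) : Fin n → ℝ) j| +
          |(Pi.single i₀ (T * Q) : Fin n → ℝ) j| := by
          simpa using abs_add_le ((c j : ℝ) - (Pi.single i₀ (T * Q) : Fin n → ℝ) j)
            ((Pi.single i₀ (T * Q) : Fin n → ℝ) j)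
      _ ≤ K * Q + T * Q := add_le_add (hc j) hs
      _ = _ := by ring
  · rw [sub_neg_eq_add] at h₀
    refine h₀.trans_eq ?_
    rw [mul_zpow]
    ring
  · rw [abs_of_nonneg (hQ0.le.trans hlow)]
    linarith
end

section
/- Let g ∈ C²([a,b]) and let Q, C₃, M > 0 be constants satisfying M · 2C₃Q^{−n−1} ≤ Q/2. Suppose x₀ ∈ [a + 2C₃Q^{−n−1}, b − 2C₃Q^{−n−1}] satisfies |g(x₀)| ≤ C₃Q^{−n} and |g'(x₀)| ≥ Q, and that |g''(x)| ≤ M for all x ∈ [a,b]. Then there exists α ∈ (x₀ − 2C₃Q^{−n−1}, x₀ + 2C₃Q^{−n−1}) with g(α) = 0. -/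
open MeasureTheory Filter Set

/-- A function whose derivative exceeds `m` on an open interval of radius `r` around `x₀`, and
whose value at `x₀` is at most `m * r` in absolute value, vanishes inside that interval. -/
theorem exists_zero_of_lt_deriv {f f' : ℝ → ℝ} {x₀ r m : ℝ} (hr : 0 < r)
    (hc : ContinuousOn f (Icc (x₀ - r) (x₀ + r)))
    (hd : ∀ x ∈ Ioo (x₀ - r) (x₀ + r), HasDerivAt f (f' x) x)
    (hm : ∀ x ∈ Ioo (x₀ - r) (x₀ + r), m < f' x) (h₀ : |f x₀| ≤ m * r) :
    ∃ α ∈ Ioo (x₀ - r) (x₀ + r), f α = 0 := by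
  obtain ⟨h₁, h₂⟩ := abs_le.1 h₀
  obtain ⟨c, hcm, hce⟩ := exists_hasDerivAt_eq_slope f f' (show x₀ < x₀ + r by linarith)
    (hc.mono (Icc_subset_Icc (by linarith) le_rfl))
    fun x hx => hd x ⟨by linarith [hx.1], hx.2⟩
  obtain ⟨d, hdm, hde⟩ := exists_hasDerivAt_eq_slope f f' (show x₀ - r < x₀ by linarith)
    (hc.mono (Icc_subset_Icc le_rfl (by linarith)))
    fun x hx => hd x ⟨hx.1, by linarith [hx.2]⟩
  have hmc := hm c ⟨by linarith [hcm.1], hcm.2⟩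
  have hmd := hm d ⟨hdm.1, by linarith [hdm.2]⟩
  rw [hce, add_sub_cancel_left, lt_div_iff₀ hr] at hmc
  rw [hde, sub_sub_cancel, lt_div_iff₀ hr] at hmd
  exact intermediate_value_Ioo (by linarith) hc ⟨by linarith, by linarith⟩

/-- On a compact interval, the derivative of a `C²` function is Lipschitz with any constant that
bounds the second derivative. -/
theorem abs_derivWithin_sub_le {a b : ℝ} (hab : a < b) {g : ℝ → ℝ}
    (hg : ContDiffOn ℝ 2 g (Icc a b)) {M : ℝ}
    (hM : ∀ x ∈ Icc a b, |iteratedDerivWithin 2 g (Icc a b) x| ≤ M)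
    {x y : ℝ} (hx : x ∈ Icc a b) (hy : y ∈ Icc a b) :
    |derivWithin g (Icc a b) y - derivWithin g (Icc a b) x| ≤ M * |y - x| := by
  have hd : DifferentiableOn ℝ (derivWithin g (Icc a b)) (Icc a b) :=
    (hg.derivWithin (m := 1) (uniqueDiffOn_Icc hab) (by norm_num)).differentiableOn (by norm_num)
  refine (convex_Icc a b).norm_image_sub_le_of_norm_derivWithin_le hd (fun z hz => ?_) hx hy
  have := hM z hz
  rwa [iteratedDerivWithin_succ, iteratedDerivWithin_one] at this

theorem stmt_9 (n : ℕ) (hn : 1 ≤ n) (a b : ℝ) (hab : a < b)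
    (g : ℝ → ℝ) (hg : ContDiffOn ℝ 2 g (Icc a b))
    (Q C₃ M : ℝ) (hQ : 0 < Q) (hC₃ : 0 < C₃) (hM : 0 < M)
    (hQM : M * (2 * C₃ * Q ^ (-(n : ℤ) - 1)) ≤ Q / 2)
    (x₀ : ℝ)
    (hx₀ : x₀ ∈ Icc (a + 2 * C₃ * Q ^ (-(n : ℤ) - 1)) (b - 2 * C₃ * Q ^ (-(n : ℤ) - 1)))
    (hg0 : |g x₀| ≤ C₃ * Q ^ (-(n : ℤ)))
    (hg1 : Q ≤ |derivWithin g (Icc a b) x₀|)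
    (hg2 : ∀ x ∈ Icc a b, |iteratedDerivWithin 2 g (Icc a b) x| ≤ M) :
    ∃ α ∈ Ioo (x₀ - 2 * C₃ * Q ^ (-(n : ℤ) - 1)) (x₀ + 2 * C₃ * Q ^ (-(n : ℤ) - 1)),
      g α = 0 := by
  have hr : 0 < 2 * C₃ * Q ^ (-(n : ℤ) - 1) := by positivity
  have h₀ : |g x₀| ≤ Q / 2 * (2 * C₃ * Q ^ (-(n : ℤ) - 1)) := by
    refine hg0.trans_eq ?_
    rw [zpow_sub_one₀ hQ.ne']
    field_simp
  generalize 2 * C₃ * Q ^ (-(n : ℤ) - 1) = r at *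
  obtain ⟨hx₁, hx₂⟩ := hx₀
  have hc : ContinuousOn g (Icc (x₀ - r) (x₀ + r)) :=
    hg.continuousOn.mono (Icc_subset_Icc (by linarith) (by linarith))
  have hd : ∀ x ∈ Ioo (x₀ - r) (x₀ + r), HasDerivAt g (derivWithin g (Icc a b) x) x := by
    intro x hx
    have hxa : a < x := by linarith [hx.1]
    have hxb : x < b := by linarith [hx.2]
    exact ((hg.differentiableOn (by norm_num)) x ⟨hxa.le, hxb.le⟩).hasDerivWithinAt.hasDerivAt
      (Icc_mem_nhds hxa hxb)
  have hlip : ∀ x ∈ Ioo (x₀ - r) (x₀ + r),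
      |derivWithin g (Icc a b) x - derivWithin g (Icc a b) x₀| < Q / 2 := by
    intro x hx
    have hxr : |x - x₀| < r := abs_lt.2 ⟨by linarith [hx.1], by linarith [hx.2]⟩
    calc _ ≤ M * |x - x₀| := abs_derivWithin_sub_le hab hg hg2
            ⟨by linarith, by linarith⟩ ⟨by linarith [hx.1], by linarith [hx.2]⟩
      _ < M * r := by gcongr
      _ ≤ Q / 2 := hQM
  rcases le_abs.1 hg1 with h | h
  · exact exists_zero_of_lt_deriv hr hc hd
      (fun x hx => by linarith [(abs_lt.1 (hlip x hx)).1]) h₀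
  · obtain ⟨α, hα, hα₀⟩ := exists_zero_of_lt_deriv (m := Q / 2) hr hc.neg
      (fun x hx => (hd x hx).neg)
      (fun x hx => by linarith [(abs_lt.1 (hlip x hx)).2]) (by simpa using h₀)
    exact ⟨α, hα, neg_eq_zero.1 hα₀⟩
end

section
/- (Pyartly's lemma) Let δ, ν > 0, let I ⊂ ℝ be an interval, let n ≥ 1, and let φ ∈ Cⁿ(I) be such that |φ^(n)(x)| > δ for all x ∈ I. Then there exists a constant c(n), depending only on n, such that the Lebesgue measure of {x ∈ I : |φ(x)| < ν} is at most c(n)·(ν/δ)^{1/n}. -/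
open MeasureTheory Filter Set

/-- If `|g'| ≥ δ` on an interval `S`, then `g` expands distances on `S` by at least `δ`. -/
theorem mul_abs_sub_le_of_le_abs_deriv {S : Set ℝ} (hS : S.OrdConnected) {g g' : ℝ → ℝ} {δ : ℝ}
    (hg : ∀ x ∈ S, HasDerivWithinAt g (g' x) S x) (hδ : ∀ x ∈ S, δ ≤ |g' x|)
    {x y : ℝ} (hx : x ∈ S) (hy : y ∈ S) : δ * |x - y| ≤ |g x - g y| := by
  wlog hxy : x < y generalizing x y
  · rcases (not_lt.mp hxy).eq_or_lt with h | h
    · simp [h]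
    · rw [abs_sub_comm x, abs_sub_comm (g x)]
      exact this hy hx h
  have hsub : Icc x y ⊆ S := hS.out hx hy
  obtain ⟨ξ, hξ, hslope⟩ := exists_hasDerivAt_eq_slope g g' hxy
    (fun z hz => ((hg z (hsub hz)).continuousWithinAt).mono hsub)
    (fun z hz => (hg z (hsub (Ioo_subset_Icc_self hz))).hasDerivAt
      (mem_of_superset (Icc_mem_nhds hz.1 hz.2) hsub))
  have hne : y - x ≠ 0 := (sub_pos.mpr hxy).ne'
  have heq : g y - g x = g' ξ * (y - x) := by rw [hslope]; field_simp
  rw [abs_sub_comm x, abs_sub_comm (g x), heq, abs_mul]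
  exact mul_le_mul_of_nonneg_right (hδ ξ (hsub (Ioo_subset_Icc_self hξ))) (abs_nonneg _)

/-- Sublevel set estimate for a chain of successive derivatives on an interval. -/
theorem volume_sublevel_le_of_le_abs_iterated_deriv (n : ℕ) (f : ℕ → ℝ → ℝ) {δ t : ℝ}
    (hδ : 0 < δ) (ht : 0 < t) {S : Set ℝ} (hS : S.OrdConnected)
    (hf : ∀ i < n, ∀ x ∈ S, HasDerivWithinAt (f i) (f (i + 1) x) S x)
    (hn : ∀ x ∈ S, δ ≤ |f n x|) :
    volume {x ∈ S | |f 0 x| < δ * t ^ n} ≤ ENNReal.ofReal (2 * (2 ^ n - 1) * t) := by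
  induction n generalizing δ S with
  | zero =>
    have : {x ∈ S | |f 0 x| < δ * t ^ 0} = ∅ := by
      ext x
      simpa using hn x
    rw [this, measure_empty]
    exact zero_le
  | succ n ih =>
    have hexp : ∀ x ∈ S, ∀ y ∈ S, δ * |x - y| ≤ |f n x - f n y| := fun x hx y hy =>
      mul_abs_sub_le_of_le_abs_deriv hS (hf n n.lt_succ_self) hn hx hy
    have hinj : InjOn (f n) S := by
      intro x hx y hy hxy
      have h := hexp x hx y hy
      rw [hxy, sub_self, abs_zero] at h
      have h0 : |x - y| ≤ 0 := by
        by_contra! hpos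
        exact absurd h (not_le.mpr (mul_pos hδ hpos))
      exact sub_eq_zero.mp (abs_nonpos_iff.mp h0)
    have hcont : ContinuousOn (f n) S := fun x hx =>
      (hf n n.lt_succ_self x hx).continuousWithinAt
    have hmono : ∀ x ∈ S, ∀ y ∈ S, x ≤ y →
        MonotoneOn (f n) (Icc x y) ∨ AntitoneOn (f n) (Icc x y) := fun x hx y hy hxy =>
      (ContinuousOn.strictMonoOn_of_injOn_Icc' hxy (hcont.mono (hS.out hx hy))
        (hinj.mono (hS.out hx hy))).imp (·.monotoneOn) (·.antitoneOn)
    have hup : {x ∈ S | δ * t ≤ f n x}.OrdConnected := by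
      refine ⟨fun x hx y hy z hz => ⟨hS.out hx.1 hy.1 hz, ?_⟩⟩
      have hxy := hz.1.trans hz.2
      rcases hmono x hx.1 y hy.1 hxy with h | h
      · exact hx.2.trans (h (left_mem_Icc.mpr hxy) hz hz.1)
      · exact hy.2.trans (h hz (right_mem_Icc.mpr hxy) hz.2)
    have hdown : {x ∈ S | f n x ≤ -(δ * t)}.OrdConnected := by
      refine ⟨fun x hx y hy z hz => ⟨hS.out hx.1 hy.1 hz, ?_⟩⟩
      have hxy := hz.1.trans hz.2
      rcases hmono x hx.1 y hy.1 hxy with h | h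
      · exact (h hz (right_mem_Icc.mpr hxy) hz.2).trans hy.2
      · exact (h (left_mem_Icc.mpr hxy) hz hz.1).trans hx.2
    have hrestrict : ∀ T ⊆ S, T.OrdConnected → (∀ x ∈ T, δ * t ≤ |f n x|) →
        volume {x ∈ T | |f 0 x| < δ * t * t ^ n} ≤ ENNReal.ofReal (2 * (2 ^ n - 1) * t) :=
      fun T hTS hT hle => ih (mul_pos hδ ht) hT
        (fun i hi x hx => (hf i (hi.trans n.lt_succ_self) x (hTS hx)).mono hTS) hle
    have h1 := hrestrict _ (sep_subset _ _) hup fun x hx => hx.2.trans (le_abs_self _)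
    have h2 := hrestrict _ (sep_subset _ _) hdown fun x hx =>
      (le_neg_of_le_neg hx.2).trans (neg_le_abs _)
    have h3 : volume {x ∈ S | |f n x| < δ * t} ≤ ENNReal.ofReal (2 * t) := by
      refine (Real.volume_le_diam _).trans (Metric.ediam_le fun x hx y hy => ?_)
      rw [edist_dist, Real.dist_eq]
      refine ENNReal.ofReal_le_ofReal (le_of_mul_le_mul_left ?_ hδ)
      have hx' := abs_lt.mp hx.2
      have hy' := abs_lt.mp hy.2
      refine (hexp x hx.1 y hy.1).trans (abs_le.mpr ⟨?_, ?_⟩) <;> linarith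
    have hcover : {x ∈ S | |f 0 x| < δ * t ^ (n + 1)} ⊆
        {x ∈ S | |f n x| < δ * t} ∪
          ({x ∈ {x ∈ S | δ * t ≤ f n x} | |f 0 x| < δ * t * t ^ n} ∪
            {x ∈ {x ∈ S | f n x ≤ -(δ * t)} | |f 0 x| < δ * t * t ^ n}) := by
      rintro x ⟨hxS, hx⟩
      have hx' : |f 0 x| < δ * t * t ^ n := by rwa [mul_assoc, ← pow_succ']
      rcases lt_or_ge |f n x| (δ * t) with h | h
      · exact Or.inl ⟨hxS, h⟩
      · rcases le_abs'.mp h with h | h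
        · exact Or.inr (Or.inr ⟨⟨hxS, h⟩, hx'⟩)
        · exact Or.inr (Or.inl ⟨⟨hxS, h⟩, hx'⟩)
    have hpow : (1 : ℝ) ≤ 2 ^ n := one_le_pow₀ one_le_two
    have hnonneg : 0 ≤ 2 * (2 ^ n - 1) * t :=
      mul_nonneg (mul_nonneg zero_le_two (sub_nonneg.mpr hpow)) ht.le
    calc _ ≤ _ := measure_mono hcover
      _ ≤ _ := (measure_union_le _ _).trans (add_le_add h3
        ((measure_union_le _ _).trans (add_le_add h1 h2)))
      _ = ENNReal.ofReal (2 * (2 ^ (n + 1) - 1) * t) := by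
        rw [← ENNReal.ofReal_add hnonneg hnonneg, ← ENNReal.ofReal_add (by positivity)
          (add_nonneg hnonneg hnonneg)]
        congr 1
        ring

theorem stmt_11 (n : ℕ) (hn : 1 ≤ n) :
    ∃ c : ℝ, 0 < c ∧
      ∀ (δ ν : ℝ), 0 < δ → 0 < ν → ∀ a b : ℝ, ∀ φ : ℝ → ℝ,
        ContDiffOn ℝ n φ (Icc a b) →
        (∀ x ∈ Icc a b, δ < |iteratedDerivWithin n φ (Icc a b) x|) →
        volume {x ∈ Icc a b | |φ x| < ν} ≤
          ENNReal.ofReal (c * (ν / δ) ^ ((1 : ℝ) / (n : ℝ))) := by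
  have hpow : (1 : ℝ) < 2 ^ n := one_lt_pow₀ one_lt_two (Nat.one_le_iff_ne_zero.mp hn)
  refine ⟨2 * (2 ^ n - 1), by linarith, fun δ ν hδ hν a b φ hφ hlow => ?_⟩
  rcases le_or_gt b a with hab | hab
  · have hzero : volume {x ∈ Icc a b | |φ x| < ν} = 0 :=
      measure_mono_null (sep_subset _ _) (by simp [hab])
    rw [hzero]
    exact zero_le
  have hquot : 0 < ν / δ := div_pos hν hδ
  have hlevel : δ * ((ν / δ) ^ ((1 : ℝ) / (n : ℝ))) ^ n = ν := by
    rw [one_div, Real.rpow_inv_natCast_pow hquot.le (Nat.one_le_iff_ne_zero.mp hn)]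
    field_simp
  have huniq := uniqueDiffOn_Icc hab
  have h := volume_sublevel_le_of_le_abs_iterated_deriv n
    (fun i => iteratedDerivWithin i φ (Icc a b)) hδ
    (Real.rpow_pos_of_pos hquot ((1 : ℝ) / (n : ℝ))) ordConnected_Icc
    (fun i hi x hx => by
      simp only [iteratedDerivWithin_succ]
      exact (hφ.differentiableOn_iteratedDerivWithin (by exact_mod_cast hi) huniq x
        hx).hasDerivWithinAt)
    (fun x hx => (hlow x hx).le)
  simpa only [hlevel, iteratedDerivWithin_zero] using h
end

section
/- Let I ⊂ ℝ be a compact interval and f, λ ∈ C²(I) with 0 < c₁ ≤ |f''(x)| ≤ c₂ for all x ∈ I. Then there exist constants C₁ > 0, ε₀ > 0 and H₀ > 0 such that for every F ∈ F₂ with H(F) ≥ H₀ and every subinterval J ⊂ I of length |J| ≤ ε₀, at least one of the following holds: |F'(x)+λ'(x)| > C₁H(F) for all x ∈ J, or |F''(x)+λ''(x)| > C₁H(F) for all x ∈ J. -/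
open MeasureTheory Filter Set

/-- The first derivative of a `C²` function on a compact interval is bounded. -/
lemma ContDiffOn.exists_abs_derivWithin_le {a b : ℝ} (hab : a < b) {g : ℝ → ℝ}
    (hg : ContDiffOn ℝ 2 g (Icc a b)) :
    ∃ M : ℝ, 0 ≤ M ∧ ∀ x ∈ Icc a b, |derivWithin g (Icc a b) x| ≤ M := by
  obtain ⟨M, hM⟩ := isCompact_Icc.exists_bound_of_continuousOn
    (hg.continuousOn_derivWithin (uniqueDiffOn_Icc hab) (by norm_num))
  exact ⟨M, (norm_nonneg _).trans (hM a (left_mem_Icc.2 hab.le)), hM⟩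

/-- The second derivative of a `C²` function on a compact interval is bounded. -/
lemma ContDiffOn.exists_abs_iteratedDerivWithin_two_le {a b : ℝ} (hab : a < b) {g : ℝ → ℝ}
    (hg : ContDiffOn ℝ 2 g (Icc a b)) :
    ∃ M : ℝ, 0 ≤ M ∧ ∀ x ∈ Icc a b, |iteratedDerivWithin 2 g (Icc a b) x| ≤ M := by
  obtain ⟨M, hM⟩ := isCompact_Icc.exists_bound_of_continuousOn
    (hg.continuousOn_iteratedDerivWithin (m := 2) (by norm_num) (uniqueDiffOn_Icc hab))
  exact ⟨M, (norm_nonneg _).trans (hM a (left_mem_Icc.2 hab.le)), hM⟩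

theorem stmt_12 (a b : ℝ) (hab : a < b)
    (f lam : ℝ → ℝ)
    (hf : ContDiffOn ℝ 2 f (Icc a b)) (hlam : ContDiffOn ℝ 2 lam (Icc a b))
    (c₁ c₂ : ℝ) (hc₁ : 0 < c₁)
    (hf'' : ∀ x ∈ Icc a b, c₁ ≤ |iteratedDerivWithin 2 f (Icc a b) x| ∧
      |iteratedDerivWithin 2 f (Icc a b) x| ≤ c₂) :
    ∃ C₁ ε₀ H₀ : ℝ, 0 < C₁ ∧ 0 < ε₀ ∧ 0 < H₀ ∧
      ∀ a₀ a₁ a₂ : ℤ, ¬(a₀ = 0 ∧ a₁ = 0 ∧ a₂ = 0) →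
        H₀ ≤ ((max a₁.natAbs a₂.natAbs : ℕ) : ℝ) →
        ∀ u v : ℝ, u ≤ v → Icc u v ⊆ Icc a b → v - u ≤ ε₀ →
          (∀ x ∈ Icc u v,
              C₁ * ((max a₁.natAbs a₂.natAbs : ℕ) : ℝ) <
                |(a₁ : ℝ) + (a₂ : ℝ) * derivWithin f (Icc a b) x +
                  derivWithin lam (Icc a b) x|) ∨
          (∀ x ∈ Icc u v,
              C₁ * ((max a₁.natAbs a₂.natAbs : ℕ) : ℝ) <
                |(a₂ : ℝ) * iteratedDerivWithin 2 f (Icc a b) x +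
                  iteratedDerivWithin 2 lam (Icc a b) x|) := by
  obtain ⟨M, hM0, hM⟩ := hf.exists_abs_derivWithin_le hab
  obtain ⟨L₁, hL₁0, hL₁⟩ := hlam.exists_abs_derivWithin_le hab
  obtain ⟨L₂, hL₂0, hL₂⟩ := hlam.exists_abs_iteratedDerivWithin_two_le hab
  obtain ⟨δ, hδ⟩ : ∃ δ : ℝ, δ = 1 / (2 * (M + 1)) := ⟨_, rfl⟩
  have hδ0 : 0 < δ := by rw [hδ]; positivity
  have hδM : δ * M + δ = 1 / 2 := by rw [hδ]; field_simp
  have hδM0 : 0 ≤ δ * M := by positivity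
  obtain ⟨m, hm⟩ : ∃ m : ℝ, m = min (1 / 2) (δ * c₁) := ⟨_, rfl⟩
  have hm0 : 0 < m := by rw [hm]; positivity
  have hm1 : m ≤ 1 / 2 := hm ▸ min_le_left _ _
  have hm2 : m ≤ δ * c₁ := hm ▸ min_le_right _ _
  refine ⟨m / 4, 1, 2 * (L₁ + L₂ + 1) / m, by positivity, one_pos, by positivity, ?_⟩
  intro a₀ a₁ a₂ _ hH u v _ hJ _
  have hHmax : ((max a₁.natAbs a₂.natAbs : ℕ) : ℝ) = max |(a₁ : ℝ)| |(a₂ : ℝ)| := by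
    push_cast [Nat.cast_natAbs]
    rfl
  rw [hHmax] at hH ⊢
  obtain ⟨H, hHdef⟩ : ∃ H : ℝ, H = max |(a₁ : ℝ)| |(a₂ : ℝ)| := ⟨_, rfl⟩
  rw [← hHdef] at hH ⊢
  rw [div_le_iff₀ hm0] at hH
  have hH0 : 0 < H := by
    by_contra! h
    nlinarith
  rcases le_or_gt (δ * H) |(a₂ : ℝ)| with h | h
  · right
    intro x hx
    have hfx := (hf'' x (hJ hx)).1
    have hlx := hL₂ x (hJ hx)
    have hprod : δ * H * c₁ ≤ |(a₂ : ℝ) * iteratedDerivWithin 2 f (Icc a b) x| := by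
      rw [abs_mul]
      gcongr
    have htri := abs_sub_abs_le_abs_add
      ((a₂ : ℝ) * iteratedDerivWithin 2 f (Icc a b) x) (iteratedDerivWithin 2 lam (Icc a b) x)
    have hmH : m * H ≤ δ * c₁ * H := by gcongr
    linarith
  · left
    intro x hx
    have hfx := hM x (hJ hx)
    have hlx := hL₁ x (hJ hx)
    have ha₁ : H = |(a₁ : ℝ)| := by
      rcases max_choice |(a₁ : ℝ)| |(a₂ : ℝ)| with h' | h'
      · rw [hHdef, h']
      · rw [← hHdef] at h'
        nlinarith
    have hprod : |(a₂ : ℝ) * derivWithin f (Icc a b) x| ≤ δ * H * M := by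
      rw [abs_mul]
      gcongr
    have htri := abs_sub_abs_le_abs_add
      ((a₁ : ℝ) + (a₂ : ℝ) * derivWithin f (Icc a b) x) (derivWithin lam (Icc a b) x)
    have htri' := abs_sub_abs_le_abs_add (a₁ : ℝ) ((a₂ : ℝ) * derivWithin f (Icc a b) x)
    have hmH : m * H ≤ 1 / 2 * H := by gcongr
    nlinarith
end

section
/- Let A, B, C, D be integers with (A,B,C) ≠ (0,0,0) and gcd(A,B,C) = 1. Then any three non-collinear points of ℤ³ lying on the plane {(x,y,z) ∈ ℝ³ : Ax+By+Cz = D} span a triangle whose area is at least (1/2)·√(A²+B²+C²). -/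
open MeasureTheory Filter Set

/-- Three points of `ι → K` are collinear when all `2 × 2` minors of their difference vectors
vanish. -/
lemma collinear_triple_of_minors_eq {ι K : Type*} [Field K] {u v w : ι → K}
    (h : ∀ i j, (v i - u i) * (w j - u j) = (v j - u j) * (w i - u i)) :
    Collinear K ({u, v, w} : Set (ι → K)) := by
  by_cases huv : v = u
  · subst huv
    simpa using collinear_pair K v w
  · obtain ⟨i, hi⟩ := Function.ne_iff.mp huv
    have hi' : v i - u i ≠ 0 := sub_ne_zero.mpr hi
    rw [collinear_iff_of_mem (p₀ := u) (by simp)]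
    refine ⟨v - u, ?_⟩
    rintro p (rfl | rfl | rfl)
    · exact ⟨0, by simp⟩
    · exact ⟨1, by simp⟩
    · refine ⟨(p i - u i) / (v i - u i), funext fun j => ?_⟩
      simp only [vadd_eq_add, Pi.add_apply, Pi.smul_apply, Pi.sub_apply, smul_eq_mul]
      field_simp
      linear_combination h i j

/-- An integer vector parallel to a primitive integer vector `(A, B, C)` is an integer multiple
of it. -/
lemma exists_eq_mul_of_gcd_eq_one {A B C x y z : ℤ} (hgcd : Int.gcd (Int.gcd A B) C = 1)
    (hxy : A * y = B * x) (hyz : B * z = C * y) (hzx : C * x = A * z) :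
    ∃ k : ℤ, x = k * A ∧ y = k * B ∧ z = k * C := by
  have h₁ := Int.gcd_eq_gcd_ab A B
  have h₂ := Int.gcd_eq_gcd_ab (Int.gcd A B) C
  rw [hgcd] at h₂
  generalize Int.gcdA (Int.gcd A B) C = r at h₂
  generalize Int.gcdB (Int.gcd A B) C = c at h₂
  generalize Int.gcdA A B = a at h₁
  generalize Int.gcdB A B = b at h₁
  rw [h₁] at h₂
  push_cast at h₂
  refine ⟨a * r * x + b * r * y + c * z, ?_, ?_, ?_⟩
  · linear_combination x * h₂ - b * r * hxy + c * hzx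
  · linear_combination y * h₂ + a * r * hxy - c * hyz
  · linear_combination z * h₂ - a * r * hzx + b * r * hyz

theorem stmt_14 (A B C D : ℤ) (hABC : ¬(A = 0 ∧ B = 0 ∧ C = 0))
    (hgcd : Int.gcd (Int.gcd A B) C = 1)
    (u v w : Fin 3 → ℤ)
    (hu : A * u 0 + B * u 1 + C * u 2 = D)
    (hv : A * v 0 + B * v 1 + C * v 2 = D)
    (hw : A * w 0 + B * w 1 + C * w 2 = D)
    (hncol : ¬ Collinear ℝ ({fun i => (u i : ℝ), fun i => (v i : ℝ),
      fun i => (w i : ℝ)} : Set (Fin 3 → ℝ))) :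
    (1 / 2 : ℝ) * Real.sqrt ((A : ℝ) ^ 2 + (B : ℝ) ^ 2 + (C : ℝ) ^ 2) ≤
      (1 / 2 : ℝ) * Real.sqrt
        ((((v 1 : ℝ) - u 1) * ((w 2 : ℝ) - u 2) -
            ((v 2 : ℝ) - u 2) * ((w 1 : ℝ) - u 1)) ^ 2 +
         (((v 2 : ℝ) - u 2) * ((w 0 : ℝ) - u 0) -
            ((v 0 : ℝ) - u 0) * ((w 2 : ℝ) - u 2)) ^ 2 +
         (((v 0 : ℝ) - u 0) * ((w 1 : ℝ) - u 1) -
            ((v 1 : ℝ) - u 1) * ((w 0 : ℝ) - u 0)) ^ 2) := by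
  obtain ⟨k, hx, hy, hz⟩ := exists_eq_mul_of_gcd_eq_one
    (x := (v 1 - u 1) * (w 2 - u 2) - (v 2 - u 2) * (w 1 - u 1))
    (y := (v 2 - u 2) * (w 0 - u 0) - (v 0 - u 0) * (w 2 - u 2))
    (z := (v 0 - u 0) * (w 1 - u 1) - (v 1 - u 1) * (w 0 - u 0)) hgcd
    (by linear_combination (v 2 - u 2) * (hw - hu) - (w 2 - u 2) * (hv - hu))
    (by linear_combination (v 0 - u 0) * (hw - hu) - (w 0 - u 0) * (hv - hu))
    (by linear_combination (v 1 - u 1) * (hw - hu) - (w 1 - u 1) * (hv - hu))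
  have hk : k ≠ 0 := by
    rintro rfl
    refine hncol (collinear_triple_of_minors_eq fun i j => ?_)
    norm_cast
    fin_cases i <;> fin_cases j <;> simp only [Fin.zero_eta, Fin.mk_one, Fin.reduceFinMk] <;>
      linarith
  have hk1 : (1 : ℝ) ≤ (k : ℝ) ^ 2 := by
    exact_mod_cast Int.add_one_le_iff.mpr (by positivity : 0 < k ^ 2)
  have hx' := congrArg (Int.cast : ℤ → ℝ) hx
  have hy' := congrArg (Int.cast : ℤ → ℝ) hy
  have hz' := congrArg (Int.cast : ℤ → ℝ) hz
  push_cast at hx' hy' hz'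
  rw [hx', hy', hz']
  gcongr (1 / 2 : ℝ) * Real.sqrt ?_
  nlinarith [mul_le_mul_of_nonneg_right hk1
    (by positivity : (0 : ℝ) ≤ (A : ℝ) ^ 2 + (B : ℝ) ^ 2 + (C : ℝ) ^ 2)]
end

section
/- Let I ⊂ ℝ be a compact interval, f, λ ∈ C²(I) with 0 < c₁ ≤ |f''(x)| ≤ c₂ for all x ∈ I, let c > 1 and K > 0. Then for all sufficiently large t ∈ ℕ the following holds: for any fixed x ∈ I, all integer points (a₀,a₁,a₂) ∈ ℤ³ satisfying |a₀+a₁x+a₂f(x)+λ(x)| ≤ K·2^{(1−2c)t}, |a₁+a₂f'(x)+λ'(x)| ≤ K·2^{(1−c)t} and |a₂| ≤ 2^t lie on a single affine plane in ℝ³. -/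
open MeasureTheory Filter Set

open scoped Matrix

/-- A set of vectors in `R³` all of whose triple products vanish has a nonzero common normal. -/
lemma exists_common_normal_of_triple_product_eq_zero {R : Type*} [CommRing R] [Nontrivial R]
    {D : Set (Fin 3 → R)} (hD : ∀ u ∈ D, ∀ v ∈ D, ∀ w ∈ D, w ⬝ᵥ (u ⨯₃ v) = 0) :
    ∃ ν : Fin 3 → R, ν ≠ 0 ∧ ∀ w ∈ D, ν ⬝ᵥ w = 0 := by
  by_cases hcross : ∃ u ∈ D, ∃ v ∈ D, u ⨯₃ v ≠ 0
  · obtain ⟨u, hu, v, hv, huv⟩ := hcross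
    exact ⟨_, huv, fun w hw ↦ by rw [dotProduct_comm, hD u hu v hv w hw]⟩
  push Not at hcross
  by_cases hzero : ∃ u ∈ D, u ≠ 0
  · obtain ⟨u, hu, hu0⟩ := hzero
    have he : ∃ e : Fin 3 → R, u ⨯₃ e ≠ 0 := by
      by_contra! h
      have h₀ := h ![1, 0, 0]
      have h₁ := h ![0, 1, 0]
      simp only [cross_apply] at h₀ h₁
      have h₂ := congrFun h₀ 1
      have h₃ := congrFun h₀ 2
      have h₄ := congrFun h₁ 0
      simp at h₂ h₃ h₄
      apply hu0
      ext i
      fin_cases i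
      · have h₅ := congrFun h₁ 2
        simpa using h₅
      · simpa using h₃
      · simpa using h₂
    obtain ⟨e, he⟩ := he
    refine ⟨_, he, fun w hw ↦ ?_⟩
    rw [dotProduct_comm, triple_product_permutation, triple_product_permutation,
      ← dotProduct_comm, ← cross_anticomm, hcross u hu w hw]
    simp
  · push Not at hzero
    refine ⟨![1, 0, 0], fun h ↦ one_ne_zero (congrFun h 0), fun w hw ↦ ?_⟩
    simp [hzero w hw]

/-- A set of points of `R³` spanning only degenerate tetrahedra lies on an affine plane. -/
lemma exists_plane_of_triple_product_eq_zero {R : Type*} [CommRing R] [Nontrivial R]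
    {S : Set (Fin 3 → R)}
    (hS : ∀ p ∈ S, ∀ u ∈ S, ∀ v ∈ S, ∀ w ∈ S, (w - p) ⬝ᵥ ((u - p) ⨯₃ (v - p)) = 0) :
    ∃ ν : Fin 3 → R, ∃ d : R, ν ≠ 0 ∧ ∀ w ∈ S, ν ⬝ᵥ w = d := by
  obtain rfl | ⟨p, hp⟩ := S.eq_empty_or_nonempty
  · exact ⟨![1, 0, 0], 0, fun h ↦ one_ne_zero (congrFun h 0), by simp⟩
  obtain ⟨ν, hν, h⟩ := exists_common_normal_of_triple_product_eq_zero (D := (· - p) '' S) (by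
    rintro _ ⟨u, hu, rfl⟩ _ ⟨v, hv, rfl⟩ _ ⟨w, hw, rfl⟩
    exact hS p hp u hu v hv w hw)
  refine ⟨ν, ν ⬝ᵥ p, hν, fun w hw ↦ ?_⟩
  have := h _ ⟨w, hw, rfl⟩
  rwa [dotProduct_sub, sub_eq_zero] at this

/-- The triple product is bounded by the coordinates taken with respect to a unipotent system
of linear forms. -/
lemma abs_triple_product_le {x y z A B C : ℝ} {u : Fin 3 → Fin 3 → ℝ}
    (hA : ∀ i, |u i 0 + u i 1 * x + u i 2 * y| ≤ A) (hB : ∀ i, |u i 1 + u i 2 * z| ≤ B)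
    (hC : ∀ i, |u i 2| ≤ C) :
    |u 0 ⬝ᵥ (u 1 ⨯₃ u 2)| ≤ 6 * (A * B * C) := by
  have hterm (i j k : Fin 3) :
      |(u i 0 + u i 1 * x + u i 2 * y) * (u j 1 + u j 2 * z) * u k 2| ≤ A * B * C := by
    have hA₀ := (abs_nonneg _).trans (hA i)
    have hB₀ := (abs_nonneg _).trans (hB j)
    rw [abs_mul, abs_mul]
    gcongr
    exacts [hA i, hB j, hC k]
  have hdet : u 0 ⬝ᵥ (u 1 ⨯₃ u 2) =
      (u 0 0 + u 0 1 * x + u 0 2 * y) * (u 1 1 + u 1 2 * z) * u 2 2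
      - (u 0 0 + u 0 1 * x + u 0 2 * y) * (u 2 1 + u 2 2 * z) * u 1 2
      + (u 1 0 + u 1 1 * x + u 1 2 * y) * (u 2 1 + u 2 2 * z) * u 0 2
      - (u 1 0 + u 1 1 * x + u 1 2 * y) * (u 0 1 + u 0 2 * z) * u 2 2
      + (u 2 0 + u 2 1 * x + u 2 2 * y) * (u 0 1 + u 0 2 * z) * u 1 2
      - (u 2 0 + u 2 1 * x + u 2 2 * y) * (u 1 1 + u 1 2 * z) * u 0 2 := by
    simp only [cross_apply, dotProduct, Fin.sum_univ_three, Matrix.cons_val]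
    ring
  rw [hdet, abs_le]
  have h₁ := abs_le.mp (hterm 0 1 2)
  have h₂ := abs_le.mp (hterm 0 2 1)
  have h₃ := abs_le.mp (hterm 1 2 0)
  have h₄ := abs_le.mp (hterm 1 0 2)
  have h₅ := abs_le.mp (hterm 2 0 1)
  have h₆ := abs_le.mp (hterm 2 1 0)
  constructor <;> linarith

/-- Integer points in a thin box, given by inhomogeneous unipotent linear forms, are coplanar. -/
lemma exists_plane_of_thin_box {x y z r s A B C : ℝ} (hABC : 48 * (A * B * C) < 1) :
    ∃ ν : Fin 3 → ℤ, ∃ d : ℤ, ν ≠ 0 ∧ ∀ w : Fin 3 → ℤ,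
      |(w 0 : ℝ) + w 1 * x + w 2 * y + r| ≤ A → |(w 1 : ℝ) + w 2 * z + s| ≤ B →
      |(w 2 : ℝ)| ≤ C → ν ⬝ᵥ w = d := by
  obtain ⟨ν, d, hν, h⟩ := exists_plane_of_triple_product_eq_zero
    (S := {w : Fin 3 → ℤ | |(w 0 : ℝ) + w 1 * x + w 2 * y + r| ≤ A ∧
      |(w 1 : ℝ) + w 2 * z + s| ≤ B ∧ |(w 2 : ℝ)| ≤ C}) (by
    rintro p ⟨hp₀, hp₁, hp₂⟩ u hu v hv w hw
    have hmem : ∀ i, ![w, u, v] i ∈ {w : Fin 3 → ℤ | |(w 0 : ℝ) + w 1 * x + w 2 * y + r| ≤ A ∧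
        |(w 1 : ℝ) + w 2 * z + s| ≤ B ∧ |(w 2 : ℝ)| ≤ C} := by
      intro i
      fin_cases i
      exacts [hw, hu, hv]
    have hbound := abs_triple_product_le (x := x) (y := y) (z := z)
      (A := 2 * A) (B := 2 * B) (C := 2 * C)
      (u := fun i j ↦ (((![w, u, v] i - p) j : ℤ) : ℝ))
      (fun i ↦ by
        have h := abs_le.mp (hmem i).1
        have h' := abs_le.mp hp₀
        simp only [Pi.sub_apply, Int.cast_sub]
        exact abs_le.mpr ⟨by linarith, by linarith⟩)
      (fun i ↦ by
        have h := abs_le.mp (hmem i).2.1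
        have h' := abs_le.mp hp₁
        simp only [Pi.sub_apply, Int.cast_sub]
        exact abs_le.mpr ⟨by linarith, by linarith⟩)
      (fun i ↦ by
        have h := abs_le.mp (hmem i).2.2
        have h' := abs_le.mp hp₂
        simp only [Pi.sub_apply, Int.cast_sub]
        exact abs_le.mpr ⟨by linarith, by linarith⟩)
    rw [← Int.abs_lt_one_iff]
    have hcast : (((w - p) ⬝ᵥ ((u - p) ⨯₃ (v - p)) : ℤ) : ℝ) =
        (fun j ↦ (((w - p) j : ℤ) : ℝ)) ⬝ᵥ
          ((fun j ↦ (((u - p) j : ℤ) : ℝ)) ⨯₃ (fun j ↦ (((v - p) j : ℤ) : ℝ))) := by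
      simp [cross_apply, dotProduct, Fin.sum_univ_three]
      ring
    have : |(((w - p) ⬝ᵥ ((u - p) ⨯₃ (v - p)) : ℤ) : ℝ)| < 1 := by
      rw [hcast]
      refine hbound.trans_lt ?_
      linarith
    exact_mod_cast this)
  exact ⟨ν, d, hν, fun w h₀ h₁ h₂ ↦ h w ⟨h₀, h₁, h₂⟩⟩

theorem stmt_15 (a b : ℝ) (hab : a < b)
    (f lam : ℝ → ℝ)
    (hf : ContDiffOn ℝ 2 f (Icc a b)) (hlam : ContDiffOn ℝ 2 lam (Icc a b))
    (c₁ c₂ : ℝ) (hc₁ : 0 < c₁)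
    (hf'' : ∀ x ∈ Icc a b, c₁ ≤ |iteratedDerivWithin 2 f (Icc a b) x| ∧
      |iteratedDerivWithin 2 f (Icc a b) x| ≤ c₂)
    (c K : ℝ) (hc : 1 < c) (hK : 0 < K) :
    ∃ t₀ : ℕ, ∀ t : ℕ, t₀ ≤ t → ∀ x ∈ Icc a b,
      ∃ ν : Fin 3 → ℝ, ∃ d : ℝ, ν ≠ 0 ∧
        ∀ a₀ a₁ a₂ : ℤ,
          |(a₀ : ℝ) + (a₁ : ℝ) * x + (a₂ : ℝ) * f x + lam x| ≤
            K * (2 : ℝ) ^ ((1 - 2 * c) * t) →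
          |(a₁ : ℝ) + (a₂ : ℝ) * derivWithin f (Icc a b) x +
              derivWithin lam (Icc a b) x| ≤ K * (2 : ℝ) ^ ((1 - c) * t) →
          (|a₂| : ℝ) ≤ 2 ^ t →
          ν 0 * a₀ + ν 1 * a₁ + ν 2 * a₂ = d := by
  have hlim : Tendsto (fun t : ℕ ↦ 48 * (K * K * ((2 : ℝ) ^ (3 - 3 * c)) ^ t)) atTop (nhds 0) := by
    have h := tendsto_pow_atTop_nhds_zero_of_lt_one (r := (2 : ℝ) ^ (3 - 3 * c)) (by positivity)
      (Real.rpow_lt_one_of_one_lt_of_neg (by norm_num) (by linarith))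
    simpa using (h.const_mul (K * K)).const_mul 48
  obtain ⟨t₀, ht₀⟩ := eventually_atTop.mp (hlim.eventually_lt_const one_pos)
  refine ⟨t₀, fun t ht x _ ↦ ?_⟩
  have hvol : 48 * ((K * (2 : ℝ) ^ ((1 - 2 * c) * t)) * (K * (2 : ℝ) ^ ((1 - c) * t)) * 2 ^ t)
      < 1 := by
    refine lt_of_eq_of_lt ?_ (ht₀ t ht)
    have hpow : (2 : ℝ) ^ ((1 - 2 * c) * t) * (2 : ℝ) ^ ((1 - c) * t) * 2 ^ t =
        ((2 : ℝ) ^ (3 - 3 * c)) ^ t := by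
      rw [← Real.rpow_natCast 2 t, ← Real.rpow_natCast _ t, ← Real.rpow_mul (by norm_num),
        ← Real.rpow_add (by norm_num), ← Real.rpow_add (by norm_num)]
      ring_nf
    rw [← hpow]
    ring
  obtain ⟨ν, d, hν, h⟩ := exists_plane_of_thin_box (x := x) (y := f x)
    (z := derivWithin f (Icc a b) x) (r := lam x) (s := derivWithin lam (Icc a b) x) hvol
  refine ⟨fun i ↦ ν i, d, fun h₀ ↦ hν ?_, fun a₀ a₁ a₂ h₀ h₁ h₂ ↦ ?_⟩
  · ext i
    have := congrFun h₀ i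
    simpa using this
  · have hplane := h ![a₀, a₁, a₂] h₀ h₁ h₂
    simp only [dotProduct, Fin.sum_univ_three, Matrix.cons_val] at hplane
    dsimp only
    exact_mod_cast hplane
end

section
/- Let I ⊂ ℝ be a compact interval, f, λ ∈ C²(I) with 0 < c₁ ≤ |f''(x)| ≤ c₂ for all x ∈ I, let v > 2 and 0 < ε < v−1. Let A₂^(1) be the set of x ∈ I such that for infinitely many (a₀,a₁,a₂) ∈ ℤ³ with H := max(|a₁|,|a₂|) ≥ 1 one has |a₀+a₁x+a₂f(x)+λ(x)| < H^{−v} and |a₁+a₂f'(x)+λ'(x)| > H^{1−ε}. Then the Hausdorff dimension of A₂^(1) is at most 3/(1+v−ε). -/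
open MeasureTheory Filter Set
open scoped Topology ENNReal NNReal

/-- The Hausdorff–Cantelli lemma: if `∑ (diam Eᵢ) ^ d < ∞` then the set of points lying in
infinitely many of the `Eᵢ` is null for the `d`-dimensional Hausdorff measure. -/
theorem hausdorffMeasure_setOf_infinite_mem_eq_zero {X ι : Type*} [EMetricSpace X]
    [MeasurableSpace X] [BorelSpace X] [Countable ι] (E : ι → Set X) {d : ℝ} (hd : 0 < d)
    (h : ∑' i, Metric.ediam (E i) ^ d ≠ ∞) :
    Measure.hausdorffMeasure d {x | {i | x ∈ E i}.Infinite} = 0 := by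
  have htail := ENNReal.tendsto_tsum_compl_atTop_zero h
  have hr : Tendsto (fun s : Finset ι =>
      (∑' i : {i // i ∉ s}, Metric.ediam (E i) ^ d) ^ (1 / d)) atTop (𝓝 0) := by
    have := (ENNReal.continuous_rpow_const (y := 1 / d)).continuousAt.tendsto.comp htail
    simpa [Function.comp_def, hd] using this
  have key := Measure.hausdorffMeasure_le_liminf_tsum (ι := fun s : Finset ι => {i // i ∉ s}) d
    {x | {i | x ∈ E i}.Infinite} _ hr (fun s i => E i)
    (Eventually.of_forall fun s i => by
      have h1 : Metric.ediam (E i) ^ d ≤ ∑' i : {i // i ∉ s}, Metric.ediam (E i) ^ d :=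
        ENNReal.le_tsum i
      have h2 := ENNReal.rpow_le_rpow h1 (by positivity : 0 ≤ 1 / d)
      rwa [← ENNReal.rpow_mul, mul_one_div_cancel hd.ne', ENNReal.rpow_one] at h2)
    (Eventually.of_forall fun s x hx => by
      obtain ⟨i, hi, his⟩ := Set.Infinite.exists_notMem_finset hx s
      exact mem_iUnion.2 ⟨⟨i, his⟩, hi⟩)
  rw [htail.liminf_eq] at key
  exact le_antisymm key zero_le

theorem summable_max_one_abs_int_rpow {q : ℝ} (hq : 1 < q) :
    Summable fun n : ℤ => (max 1 |(n : ℝ)|) ^ (-q) := by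
  refine Summable.congr_cofinite (Real.summable_abs_int_rpow hq) ?_
  filter_upwards [(Set.finite_singleton (0 : ℤ)).compl_mem_cofinite] with n hn
  have h1 : (1 : ℝ) ≤ |(n : ℝ)| := by exact_mod_cast Int.one_le_abs hn
  rw [max_eq_right h1]

theorem mul_sub_le_image_sub_of_le_hasDerivWithinAt {a b : ℝ} {G G' : ℝ → ℝ}
    (hG : ∀ x ∈ Icc a b, HasDerivWithinAt G (G' x) (Icc a b) x) {x y c : ℝ}
    (hx : x ∈ Icc a b) (hy : y ∈ Icc a b) (hxy : x < y) (hc : ∀ z ∈ Icc x y, c ≤ G' z) :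
    c * (y - x) ≤ G y - G x := by
  have hsub : Icc x y ⊆ Icc a b := Icc_subset_Icc hx.1 hy.2
  obtain ⟨z, hz, hz'⟩ := exists_hasDerivAt_eq_slope G G' hxy
    (fun z hz => ((hG z (hsub hz)).continuousWithinAt).mono hsub)
    (fun z hz => (hG z (hsub (Ioo_subset_Icc_self hz))).hasDerivAt
      (Icc_mem_nhds (hx.1.trans_lt hz.1) (hz.2.trans_le hy.2)))
  have h1 := hc z (Ioo_subset_Icc_self hz)
  rwa [hz', le_div_iff₀ (sub_pos.2 hxy)] at h1

theorem min_le_of_hasDerivWithinAt_ne_zero {a b : ℝ} {G G' : ℝ → ℝ}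
    (hG : ∀ x ∈ Icc a b, HasDerivWithinAt G (G' x) (Icc a b) x)
    (hG' : ∀ x ∈ Icc a b, G' x ≠ 0) {x y z : ℝ}
    (hx : x ∈ Icc a b) (hy : y ∈ Icc a b) (hz : z ∈ Icc x y) :
    min (G x) (G y) ≤ G z := by
  have hz' : z ∈ Icc a b := ⟨hx.1.trans hz.1, hz.2.trans hy.2⟩
  have hcont : ContinuousOn G (Icc a b) := fun x hx => (hG x hx).continuousWithinAt
  have hint : ∀ x ∈ interior (Icc a b), HasDerivWithinAt G (G' x) (interior (Icc a b)) x :=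
    fun x hx => (hG x (interior_subset hx)).mono interior_subset
  rcases hasDerivWithinAt_forall_lt_or_forall_gt_of_forall_ne (convex_Icc a b) hG hG' with h | h
  · exact (min_le_right _ _).trans (antitoneOn_of_hasDerivWithinAt_nonpos (convex_Icc a b) hcont
      hint (fun x hx => (h x (interior_subset hx)).le) hz' hy hz.2)
  · exact (min_le_left _ _).trans (monotoneOn_of_hasDerivWithinAt_nonneg (convex_Icc a b) hcont
      hint (fun x hx => (h x (interior_subset hx)).le) hx hz' hz.1)

/-- If `F + l = a₀ + a₁ x + a₂ f + l` is small and has large derivative at two points, then these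
points are close to each other, provided the height of `(a₁, a₂)` is large. -/
theorem sub_le_of_abs_lt_of_lt_deriv {a b : ℝ} {f f' f'' l l' l'' : ℝ → ℝ}
    (hf : ∀ x ∈ Icc a b, HasDerivWithinAt f (f' x) (Icc a b) x)
    (hf' : ∀ x ∈ Icc a b, HasDerivWithinAt f' (f'' x) (Icc a b) x)
    (hl : ∀ x ∈ Icc a b, HasDerivWithinAt l (l' x) (Icc a b) x)
    (hl' : ∀ x ∈ Icc a b, HasDerivWithinAt l' (l'' x) (Icc a b) x)
    {c B : ℝ} (hc : 0 < c) (hB : 0 ≤ B) (hcf : ∀ x ∈ Icc a b, c ≤ |f'' x|)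
    (hBf : ∀ x ∈ Icc a b, |f' x| ≤ B) (hBl : ∀ x ∈ Icc a b, |l' x| ≤ B)
    (hBl' : ∀ x ∈ Icc a b, |l'' x| ≤ B) {v ε : ℝ} (hε : 0 < ε)
    {a₀ a₁ a₂ : ℝ} (hH : 2 * (B / c * B + B) + B / c + 1 ≤ max |a₁| |a₂|)
    {x y : ℝ} (hx : x ∈ Icc a b) (hy : y ∈ Icc a b) (hxy : x < y)
    (hGx : |a₀ + a₁ * x + a₂ * f x + l x| < (max |a₁| |a₂|) ^ (-v))
    (hGy : |a₀ + a₁ * y + a₂ * f y + l y| < (max |a₁| |a₂|) ^ (-v))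
    (hGx' : (max |a₁| |a₂|) ^ (1 - ε) < a₁ + a₂ * f' x + l' x)
    (hGy' : (max |a₁| |a₂|) ^ (1 - ε) < a₁ + a₂ * f' y + l' y) :
    y - x ≤ 4 * (max |a₁| |a₂|) ^ (-(1 + v - ε)) := by
  set h := max |a₁| |a₂| with hh
  have hBc : 0 ≤ B / c := by positivity
  have hD : 0 ≤ B / c * B + B := by positivity
  set C := B / c * B + B with hC
  have h1 : 1 ≤ h := by linarith
  have h0 : 0 < h := by linarith
  have hlow : h ^ (1 - ε) ≤ h := by
    calc h ^ (1 - ε) ≤ h ^ (1 : ℝ) := Real.rpow_le_rpow_of_exponent_le h1 (by linarith)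
      _ = h := Real.rpow_one h
  have hpos : 0 < h ^ (1 - ε) := Real.rpow_pos_of_pos h0 _
  have hder : ∀ z ∈ Icc x y, h ^ (1 - ε) / 2 ≤ a₁ + a₂ * f' z + l' z := by
    intro z hz
    by_cases hcase : B / c < |a₂|
    · have hmin := min_le_of_hasDerivWithinAt_ne_zero
        (G := fun z => a₁ + a₂ * f' z + l' z) (G' := fun z => a₂ * f'' z + l'' z)
        (fun x hx => (((hf' x hx).const_mul a₂).const_add a₁).add (hl' x hx))
        (fun x hx h0 => by
          have e : |a₂| * |f'' x| = |l'' x| := by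
            rw [← abs_mul, eq_neg_of_add_eq_zero_left h0, abs_neg]
          rw [div_lt_iff₀ hc] at hcase
          have := mul_le_mul_of_nonneg_left (hcf x hx) (abs_nonneg a₂)
          linarith [hBl' x hx]) hx hy hz
      have := (lt_min hGx' hGy').trans_le hmin
      linarith
    · push Not at hcase
      have hz' : z ∈ Icc a b := ⟨hx.1.trans hz.1, hz.2.trans hy.2⟩
      have hCle : ∀ w ∈ Icc a b, |a₂ * f' w + l' w| ≤ C := fun w hw => by
        calc |a₂ * f' w + l' w| ≤ |a₂ * f' w| + |l' w| := abs_add_le _ _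
          _ = |a₂| * |f' w| + |l' w| := by rw [abs_mul]
          _ ≤ B / c * B + B := add_le_add
            (mul_le_mul hcase (hBf w hw) (abs_nonneg _) (by positivity)) (hBl w hw)
      have e1 := abs_le.1 (hCle x hx)
      have e2 := abs_le.1 (hCle z hz')
      have ha₁ : h = a₁ := by
        have hlt : |a₂| < h := by linarith
        have hha : h = |a₁| := by
          rcases max_choice |a₁| |a₂| with e | e
          · exact e
          · exact absurd (hh.trans e) hlt.ne'
        rcases abs_choice a₁ with e | e <;> linarith
      linarith
  have hm := mul_sub_le_image_sub_of_le_hasDerivWithinAt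
    (G := fun z => a₀ + a₁ * z + a₂ * f z + l z) (G' := fun z => a₁ + a₂ * f' z + l' z)
    (fun x hx => by
      have := ((((hasDerivWithinAt_id x (Icc a b)).const_mul a₁).const_add a₀).add
        ((hf x hx).const_mul a₂)).add (hl x hx)
      rw [mul_one] at this
      exact this) hx hy hxy hder
  have hup : h ^ (1 - ε) / 2 * (y - x) ≤ 2 * h ^ (-v) := by
    linarith [(abs_lt.1 hGx).1, (abs_lt.1 hGy).2]
  have e : h ^ (-(1 + v - ε)) * h ^ (1 - ε) = h ^ (-v) := by
    rw [← Real.rpow_add h0]; ring_nf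
  refine le_of_mul_le_mul_right ?_ hpos
  nlinarith

theorem summable_prod_max_one_abs_int_rpow {q : ℝ} (hq : 1 < q) :
    Summable fun i : (ℤ × ℤ × ℤ) × ℤˣ => (max 1 |(i.1.1 : ℝ)|) ^ (-q) *
      ((max 1 |(i.1.2.1 : ℝ)|) ^ (-q) * (max 1 |(i.1.2.2 : ℝ)|) ^ (-q)) := by
  have h := summable_max_one_abs_int_rpow hq
  have hn : 0 ≤ fun n : ℤ => (max 1 |(n : ℝ)|) ^ (-q) := fun n => by positivity
  have h2 := h.mul_of_nonneg h hn hn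
  have h3 := h.mul_of_nonneg h2 hn (fun n => mul_nonneg (hn _) (hn _))
  have h4 := h3.mul_of_nonneg (Summable.of_finite (f := fun _ : ℤˣ => (1 : ℝ)))
    (fun n => mul_nonneg (hn _) (mul_nonneg (hn _) (hn _))) (fun _ => zero_le_one)
  simpa using h4

theorem dimH_le_of_hasDerivWithinAt {a b : ℝ} {f f' f'' l l' l'' : ℝ → ℝ}
    (hf : ∀ x ∈ Icc a b, HasDerivWithinAt f (f' x) (Icc a b) x)
    (hf' : ∀ x ∈ Icc a b, HasDerivWithinAt f' (f'' x) (Icc a b) x)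
    (hl : ∀ x ∈ Icc a b, HasDerivWithinAt l (l' x) (Icc a b) x)
    (hl' : ∀ x ∈ Icc a b, HasDerivWithinAt l' (l'' x) (Icc a b) x)
    {c B : ℝ} (hc : 0 < c) (hB : 0 ≤ B) (hcf : ∀ x ∈ Icc a b, c ≤ |f'' x|)
    (hBx : ∀ x ∈ Icc a b, |x| ≤ B)
    (hBf₀ : ∀ x ∈ Icc a b, |f x| ≤ B) (hBl₀ : ∀ x ∈ Icc a b, |l x| ≤ B)
    (hBf : ∀ x ∈ Icc a b, |f' x| ≤ B) (hBl : ∀ x ∈ Icc a b, |l' x| ≤ B)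
    (hBl' : ∀ x ∈ Icc a b, |l'' x| ≤ B) {v ε : ℝ} (hε : 0 < ε) (hv : 0 < v)
    (hεv : 0 < 1 + v - ε) :
    dimH {x ∈ Icc a b | {t : ℤ × ℤ × ℤ | 1 ≤ max |(t.2.1 : ℝ)| |(t.2.2 : ℝ)| ∧
        |(t.1 : ℝ) + t.2.1 * x + t.2.2 * f x + l x| <
          (max |(t.2.1 : ℝ)| |(t.2.2 : ℝ)|) ^ (-v) ∧
        (max |(t.2.1 : ℝ)| |(t.2.2 : ℝ)|) ^ (1 - ε) <
          |(t.2.1 : ℝ) + t.2.2 * f' x + l' x|}.Infinite} ≤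
      ENNReal.ofReal (3 / (1 + v - ε)) := by
  set κ := 1 + v - ε with hκ
  let H : ℤ × ℤ × ℤ → ℝ := fun t => max |(t.2.1 : ℝ)| |(t.2.2 : ℝ)|
  let h₀ : ℝ := 2 * (B / c * B + B) + B / c + 1
  have hh₀ : 1 ≤ h₀ := by
    have : 0 ≤ 2 * (B / c * B + B) + B / c := by positivity
    linarith
  let K : ℝ := 1 + 3 * B
  have hK : 1 ≤ K := by linarith
  have ha₀ : ∀ x ∈ Icc a b, ∀ t : ℤ × ℤ × ℤ, 1 ≤ H t →
      |(t.1 : ℝ) + t.2.1 * x + t.2.2 * f x + l x| < (H t) ^ (-v) → |(t.1 : ℝ)| ≤ K * H t := by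
    intro x hx t ht h
    have h1 : (H t) ^ (-v) ≤ 1 := Real.rpow_le_one_of_one_le_of_nonpos ht (by linarith)
    have h2 : |(t.2.1 : ℝ) * x| ≤ H t * B := by
      rw [abs_mul]
      exact mul_le_mul (le_max_left _ _) (hBx x hx) (abs_nonneg _) (by linarith)
    have h3 : |(t.2.2 : ℝ) * f x| ≤ H t * B := by
      rw [abs_mul]
      exact mul_le_mul (le_max_right _ _) (hBf₀ x hx) (abs_nonneg _) (by linarith)
    have h4 : B ≤ H t * B := le_mul_of_one_le_left hB ht
    have h5 := abs_le.1 h2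
    have h6 := abs_le.1 h3
    have h7 := abs_le.1 (hBl₀ x hx)
    have h8 := abs_lt.1 h
    have h9 : K * H t = H t + 3 * (H t * B) := by simp only [K]; ring
    rw [h9]
    exact abs_le.2 ⟨by linarith, by linarith⟩
  let E : (ℤ × ℤ × ℤ) × ℤˣ → Set ℝ := fun i => {x ∈ Icc a b | h₀ ≤ H i.1 ∧
    |(i.1.1 : ℝ) + i.1.2.1 * x + i.1.2.2 * f x + l x| < (H i.1) ^ (-v) ∧
    (H i.1) ^ (1 - ε) < ((i.2 : ℤ) : ℝ) * (i.1.2.1 + i.1.2.2 * f' x + l' x)}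
  have hsub : {x ∈ Icc a b | {t : ℤ × ℤ × ℤ | 1 ≤ max |(t.2.1 : ℝ)| |(t.2.2 : ℝ)| ∧
        |(t.1 : ℝ) + t.2.1 * x + t.2.2 * f x + l x| <
          (max |(t.2.1 : ℝ)| |(t.2.2 : ℝ)|) ^ (-v) ∧
        (max |(t.2.1 : ℝ)| |(t.2.2 : ℝ)|) ^ (1 - ε) <
          |(t.2.1 : ℝ) + t.2.2 * f' x + l' x|}.Infinite} ⊆ {x | {i | x ∈ E i}.Infinite} := by
    rintro x ⟨hx, hinf⟩ hfin
    refine hinf (((hfin.image Prod.fst).union (Set.finite_Icc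
      ((-⌈K * h₀⌉, -⌈K * h₀⌉, -⌈K * h₀⌉) : ℤ × ℤ × ℤ) (⌈K * h₀⌉, ⌈K * h₀⌉, ⌈K * h₀⌉))).subset ?_)
    rintro t ⟨ht, ht1, ht2⟩
    rcases le_or_gt h₀ (H t) with hlarge | hsmall
    · left
      rcases abs_choice ((t.2.1 : ℝ) + t.2.2 * f' x + l' x) with e | e <;> rw [e] at ht2
      · exact ⟨(t, 1), ⟨hx, hlarge, ht1, by simpa using ht2⟩, rfl⟩
      · exact ⟨(t, -1), ⟨hx, hlarge, ht1, by simpa using ht2⟩, rfl⟩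
    · right
      have hbound : ∀ n : ℤ, |(n : ℝ)| ≤ K * H t → -⌈K * h₀⌉ ≤ n ∧ n ≤ ⌈K * h₀⌉ := by
        intro n hn
        have h1 : K * H t ≤ K * h₀ := mul_le_mul_of_nonneg_left hsmall.le (by linarith)
        have h2 : |(n : ℝ)| ≤ ((⌈K * h₀⌉ : ℤ) : ℝ) := (hn.trans h1).trans (Int.le_ceil _)
        rw [← Int.cast_abs] at h2
        exact abs_le.1 (by exact_mod_cast h2)
      have hHK : H t ≤ K * H t := le_mul_of_one_le_left (by linarith [show 1 ≤ H t from ht]) hK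
      have b₀ := hbound _ (ha₀ x hx t ht ht1)
      have b₁ := hbound t.2.1 ((le_max_left _ _).trans hHK)
      have b₂ := hbound t.2.2 ((le_max_right _ _).trans hHK)
      exact ⟨⟨b₀.1, b₁.1, b₂.1⟩, ⟨b₀.2, b₁.2, b₂.2⟩⟩
  have hclose : ∀ i, ∀ x ∈ E i, ∀ y ∈ E i, x < y → y - x ≤ 4 * (H i.1) ^ (-κ) := by
    rintro ⟨t, σ⟩ x ⟨hx, hh, hx1, hx2⟩ y ⟨hy, -, hy1, hy2⟩ hxy
    rcases Int.units_eq_one_or σ with rfl | rfl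
    · simp only [Units.val_one, Int.cast_one, one_mul] at hx2 hy2
      exact sub_le_of_abs_lt_of_lt_deriv hf hf' hl hl' hc hB hcf hBf hBl hBl' hε hh hx hy hxy
        hx1 hy1 hx2 hy2
    · simp only [Units.val_neg, Units.val_one, Int.cast_neg, Int.cast_one, neg_mul, one_mul]
        at hx2 hy2
      have hHn : max |(-t.2.1 : ℝ)| |(-t.2.2 : ℝ)| = H t := by simp only [abs_neg, H]
      have := sub_le_of_abs_lt_of_lt_deriv (v := v) (ε := ε) (l := -l) (l' := -l') (l'' := -l'')
        (a₀ := -t.1) (a₁ := -t.2.1) (a₂ := -t.2.2) hf hf'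
        (fun x hx => (hl x hx).neg) (fun x hx => (hl' x hx).neg) hc hB hcf hBf
        (by simpa using hBl) (by simpa using hBl') hε (by rwa [hHn]) hx hy hxy
        (by
          rw [hHn, ← abs_neg]
          convert hx1 using 2
          simp only [Pi.neg_apply]; ring)
        (by
          rw [hHn, ← abs_neg]
          convert hy1 using 2
          simp only [Pi.neg_apply]; ring)
        (by
          rw [hHn]
          convert hx2 using 1
          simp only [Pi.neg_apply]; ring)
        (by
          rw [hHn]
          convert hy2 using 1
          simp only [Pi.neg_apply]; ring)
      rwa [hHn] at this
  refine (dimH_mono hsub).trans (dimH_le fun d hd => ?_)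
  by_contra! hlt
  have hlt' : 3 / κ < d := by
    rw [← ENNReal.ofReal_coe_nnreal] at hlt
    exact ((ENNReal.ofReal_lt_ofReal_iff_of_nonneg (by positivity)).1 hlt)
  have hd0 : (0 : ℝ) < d := lt_trans (by positivity) hlt'
  let q : ℝ := κ * d / 3
  have hq : 1 < q := by
    rw [div_lt_iff₀ hεv] at hlt'
    simp only [q]; linarith
  let g : (ℤ × ℤ × ℤ) × ℤˣ → ℝ := fun i => (max 1 |(i.1.1 : ℝ)|) ^ (-q) *
      ((max 1 |(i.1.2.1 : ℝ)|) ^ (-q) * (max 1 |(i.1.2.2 : ℝ)|) ^ (-q))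
  let M : ℝ := 4 ^ (d : ℝ) * K ^ (3 * q)
  have hg : ∀ i, 0 ≤ M * g i := fun i => by
    have : 0 ≤ K := by linarith
    positivity
  have hdiam : ∀ i, Metric.ediam (E i) ^ (d : ℝ) ≤ ENNReal.ofReal (M * g i) := by
    intro i
    rcases (E i).eq_empty_or_nonempty with he | ⟨x, hx⟩
    · simp [he, hd0]
    have h1 : 1 ≤ H i.1 := hh₀.trans hx.2.1
    have h0 : 0 < H i.1 := by linarith
    have hK0 : 0 < K := by linarith
    have hdi : Metric.ediam (E i) ≤ ENNReal.ofReal (4 * (H i.1) ^ (-κ)) := by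
      refine Metric.ediam_le_of_forall_dist_le fun x hx y hy => ?_
      rw [Real.dist_eq]
      rcases lt_trichotomy x y with h | h | h
      · rw [abs_sub_comm, abs_of_pos (sub_pos.2 h)]
        exact hclose i x hx y hy h
      · rw [h, sub_self, abs_zero]; positivity
      · rw [abs_of_pos (sub_pos.2 h)]
        exact hclose i y hy x hx h
    refine (ENNReal.rpow_le_rpow hdi hd0.le).trans ?_
    rw [ENNReal.ofReal_rpow_of_nonneg (by positivity) hd0.le]
    refine ENNReal.ofReal_le_ofReal ?_
    have hHK : H i.1 ≤ K * H i.1 := le_mul_of_one_le_left h0.le hK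
    have hm : ∀ n : ℤ, |(n : ℝ)| ≤ K * H i.1 →
        (K * H i.1) ^ (-q) ≤ (max 1 |(n : ℝ)|) ^ (-q) := fun n hn =>
      Real.rpow_le_rpow_of_nonpos (by positivity) (max_le (h1.trans hHK) hn) (by linarith)
    have hp : 0 ≤ (K * H i.1) ^ (-q) := by positivity
    have hprod : (K * H i.1) ^ (-q) * ((K * H i.1) ^ (-q) * (K * H i.1) ^ (-q)) ≤ g i := by
      refine mul_le_mul (hm _ (ha₀ x hx.1 i.1 h1 hx.2.2.1)) (mul_le_mul
        (hm _ ((le_max_left _ _).trans hHK)) (hm _ ((le_max_right _ _).trans hHK)) hp ?_) ?_ ?_ <;>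
      positivity
    have e1 : (4 * (H i.1) ^ (-κ)) ^ (d : ℝ) = 4 ^ (d : ℝ) * (H i.1) ^ (-(3 * q)) := by
      rw [Real.mul_rpow (by norm_num) (by positivity), ← Real.rpow_mul h0.le]
      congr 2
      simp only [q]; ring
    have e2 : (K * H i.1) ^ (-q) * ((K * H i.1) ^ (-q) * (K * H i.1) ^ (-q)) =
        K ^ (-(3 * q)) * (H i.1) ^ (-(3 * q)) := by
      rw [← Real.rpow_add (by positivity), ← Real.rpow_add (by positivity),
        ← Real.mul_rpow hK0.le h0.le]
      ring_nf
    have e3 : K ^ (3 * q) * K ^ (-(3 * q)) = 1 := by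
      rw [← Real.rpow_add hK0, add_neg_cancel, Real.rpow_zero]
    calc (4 * (H i.1) ^ (-κ)) ^ (d : ℝ)
        = M * (K ^ (-(3 * q)) * (H i.1) ^ (-(3 * q))) := by
          rw [e1]
          calc _ = 4 ^ (d : ℝ) * (K ^ (3 * q) * K ^ (-(3 * q))) * (H i.1) ^ (-(3 * q)) := by
                rw [e3, mul_one]
            _ = _ := by simp only [M]; ring
      _ ≤ M * g i := by
          rw [← e2]
          exact mul_le_mul_of_nonneg_left hprod (by positivity)
  have hsum : ∑' i, Metric.ediam (E i) ^ (d : ℝ) ≠ ∞ := by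
    refine ne_top_of_le_ne_top ?_ (ENNReal.tsum_le_tsum hdiam)
    rw [← ENNReal.ofReal_tsum_of_nonneg hg
      ((summable_prod_max_one_abs_int_rpow hq).mul_left M)]
    exact ENNReal.ofReal_ne_top
  rw [hausdorffMeasure_setOf_infinite_mem_eq_zero E hd0 hsum] at hd
  exact ENNReal.zero_ne_top hd

theorem ContDiffOn.hasDerivWithinAt_derivWithin_two {a b : ℝ} (hab : a < b) {f : ℝ → ℝ}
    (hf : ContDiffOn ℝ 2 f (Icc a b)) :
    (∀ x ∈ Icc a b, HasDerivWithinAt f (derivWithin f (Icc a b) x) (Icc a b) x) ∧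
    (∀ x ∈ Icc a b, HasDerivWithinAt (derivWithin f (Icc a b))
      (iteratedDerivWithin 2 f (Icc a b) x) (Icc a b) x) ∧
    ∃ B, 0 ≤ B ∧ ∀ x ∈ Icc a b, |f x| ≤ B ∧ |derivWithin f (Icc a b) x| ≤ B ∧
      |iteratedDerivWithin 2 f (Icc a b) x| ≤ B := by
  have hu := uniqueDiffOn_Icc hab
  have h2 : ContDiffOn ℝ (1 + 1) f (Icc a b) := by simpa [one_add_one_eq_two] using hf
  have h1 := ((contDiffOn_succ_iff_derivWithin hu).1 h2).2.2
  have hd : DifferentiableOn ℝ f (Icc a b) := hf.differentiableOn (by norm_num)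
  have hd1 := h1.differentiableOn (by norm_num)
  refine ⟨fun x hx => (hd x hx).hasDerivWithinAt, fun x hx => ?_, ?_⟩
  · rw [iteratedDerivWithin_succ, iteratedDerivWithin_one]
    exact (hd1 x hx).hasDerivWithinAt
  · obtain ⟨B₀, hB₀⟩ := isCompact_Icc.exists_bound_of_continuousOn hf.continuousOn
    obtain ⟨B₁, hB₁⟩ := isCompact_Icc.exists_bound_of_continuousOn h1.continuousOn
    obtain ⟨B₂, hB₂⟩ := isCompact_Icc.exists_bound_of_continuousOn
      (hf.continuousOn_iteratedDerivWithin (m := 2) (by norm_num) hu)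
    refine ⟨max 0 (max B₀ (max B₁ B₂)), le_max_left _ _, fun x hx => ⟨?_, ?_, ?_⟩⟩
    · exact (hB₀ x hx).trans (by simp)
    · exact (hB₁ x hx).trans (by simp)
    · exact (hB₂ x hx).trans (by simp)

theorem stmt_16 (a b : ℝ) (hab : a < b)
    (f lam : ℝ → ℝ)
    (hf : ContDiffOn ℝ 2 f (Icc a b)) (hlam : ContDiffOn ℝ 2 lam (Icc a b))
    (c₁ c₂ : ℝ) (hc₁ : 0 < c₁)
    (hf'' : ∀ x ∈ Icc a b, c₁ ≤ |iteratedDerivWithin 2 f (Icc a b) x| ∧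
      |iteratedDerivWithin 2 f (Icc a b) x| ≤ c₂)
    (v ε : ℝ) (hv : 2 < v) (hε : 0 < ε) (hεv : ε < v - 1) :
    dimH {x ∈ Icc a b |
        {t : ℤ × ℤ × ℤ | 1 ≤ (max t.2.1.natAbs t.2.2.natAbs : ℕ) ∧
          |(t.1 : ℝ) + (t.2.1 : ℝ) * x + (t.2.2 : ℝ) * f x + lam x| <
            ((max t.2.1.natAbs t.2.2.natAbs : ℕ) : ℝ) ^ (-v) ∧
          ((max t.2.1.natAbs t.2.2.natAbs : ℕ) : ℝ) ^ (1 - ε) <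
            |(t.2.1 : ℝ) + (t.2.2 : ℝ) * derivWithin f (Icc a b) x +
              derivWithin lam (Icc a b) x|}.Infinite} ≤
      ENNReal.ofReal (3 / (1 + v - ε)) := by
  obtain ⟨f1, f2, Bf, hBf0, hBf⟩ := hf.hasDerivWithinAt_derivWithin_two hab
  obtain ⟨l1, l2, Bl, hBl0, hBl⟩ := hlam.hasDerivWithinAt_derivWithin_two hab
  have hle : ∀ {r : ℝ}, r ≤ Bf → r ≤ |a| + |b| + Bf + Bl := fun h => by
    linarith [abs_nonneg a, abs_nonneg b]
  have hle' : ∀ {r : ℝ}, r ≤ Bl → r ≤ |a| + |b| + Bf + Bl := fun h => by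
    linarith [abs_nonneg a, abs_nonneg b]
  have key := dimH_le_of_hasDerivWithinAt f1 f2 l1 l2 (B := |a| + |b| + Bf + Bl) hc₁
    (by positivity) (fun x hx => (hf'' x hx).1)
    (fun x hx => (abs_le_max_abs_abs hx.1 hx.2).trans
      (max_le (by linarith [abs_nonneg b]) (by linarith [abs_nonneg a])))
    (fun x hx => hle (hBf x hx).1) (fun x hx => hle' (hBl x hx).1)
    (fun x hx => hle (hBf x hx).2.1) (fun x hx => hle' (hBl x hx).2.1)
    (fun x hx => hle' (hBl x hx).2.2) hε (by linarith : 0 < v) (by linarith)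
  have hH : ∀ t : ℤ × ℤ × ℤ, ((max t.2.1.natAbs t.2.2.natAbs : ℕ) : ℝ) =
      max |(t.2.1 : ℝ)| |(t.2.2 : ℝ)| := fun t => by
    rw [Nat.cast_max, Nat.cast_natAbs, Nat.cast_natAbs, Int.cast_abs, Int.cast_abs]
  have hH1 : ∀ t : ℤ × ℤ × ℤ, 1 ≤ (max t.2.1.natAbs t.2.2.natAbs : ℕ) ↔
      1 ≤ max |(t.2.1 : ℝ)| |(t.2.2 : ℝ)| := fun t => by
    rw [← hH, Nat.one_le_cast]
  simpa only [hH, hH1] using key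
end

section
/- Let I ⊂ ℝ be a compact interval, f, λ ∈ C²(I) with 0 < c₁ ≤ |f''(x)| ≤ c₂ for all x ∈ I, let v > 2 and δ ∈ (0,1]. Assume additionally there is a constant C₁ > 0 such that for every (a₀,a₁,a₂) ∈ ℤ³ not all zero with H := max(|a₁|,|a₂|) sufficiently large, either |a₁+a₂f'(x)+λ'(x)| > C₁H for all x ∈ I or |a₂f''(x)+λ''(x)| > C₁H for all x ∈ I. Let A_δ(v,λ) be the set of x ∈ I such that for infinitely many (a₀,a₁,a₂) ∈ ℤ³ with H ≥ 1 one has |a₀+a₁x+a₂f(x)+λ(x)| < H^{−v} and H^{1−(v+1)δ/3} < |a₁+a₂f'(x)+λ'(x)| ≤ H^{1−δ}. Then the Hausdorff dimension of A_δ(v,λ) is at most 3/(v+1). -/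
open MeasureTheory Filter Set

/-- Hausdorff–Cantelli lemma. -/
theorem dimH_setOf_infinite_le {X ι : Type*} [EMetricSpace X] [Countable ι]
    (S : ι → Set X) {d : NNReal} (hd : 0 < d)
    (h : ∑' i, Metric.ediam (S i) ^ (d : ℝ) ≠ ⊤) :
    dimH {x | {i | x ∈ S i}.Infinite} ≤ d := by
  borelize X
  have hd' : (0 : ℝ) < d := hd
  have h0 := ENNReal.tendsto_tsum_compl_atTop_zero h
  have key := Measure.hausdorffMeasure_le_liminf_tsum (d : ℝ)
    {x | {i | x ∈ S i}.Infinite} (l := atTop)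
    (fun F : Finset ι => (∑' i : {i // i ∉ F}, Metric.ediam (S i) ^ (d : ℝ)) ^ ((d : ℝ)⁻¹))
    (by simpa [ENNReal.zero_rpow_of_pos (inv_pos.2 hd')] using h0.ennrpow_const ((d : ℝ)⁻¹))
    (fun F (i : {i // i ∉ F}) => S i)
    (Eventually.of_forall fun F i => by
      rw [ENNReal.le_rpow_inv_iff hd']
      exact ENNReal.le_tsum (f := fun i : {i // i ∉ F} => Metric.ediam (S i) ^ (d : ℝ)) i)
    (Eventually.of_forall fun F x hx => by
      obtain ⟨i, hi, hiF⟩ := hx.exists_notMem_finset F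
      exact mem_iUnion.2 ⟨⟨i, hiF⟩, hi⟩)
  rw [h0.liminf_eq] at key
  exact dimH_le_of_hausdorffMeasure_ne_top (ne_top_of_le_ne_top ENNReal.zero_ne_top key)

theorem tsum_max_natAbs_rpow_ne_top {p : ℝ} (hp : 2 < p) :
    ∑' q : ℤ × ℤ, ENNReal.ofReal (((max q.1.natAbs q.2.natAbs : ℕ) : ℝ) ^ (-p)) ≠ ⊤ := by
  have h := (EisensteinSeries.summable_one_div_norm_rpow hp).tsum_ofReal_ne_top
  rw [← (finTwoArrowEquiv ℤ).symm.tsum_eq] at h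
  convert h using 7 with q
  have key : ‖(finTwoArrowEquiv ℤ).symm q‖ = max ‖q.1‖ ‖q.2‖ := by
    apply le_antisymm
    · rw [pi_norm_le_iff_of_nonneg (by positivity)]
      intro i; fin_cases i <;> simp [finTwoArrowEquiv]
    · exact max_le (by simpa [finTwoArrowEquiv] using
        norm_le_pi_norm ((finTwoArrowEquiv ℤ).symm q) 0)
        (by simpa [finTwoArrowEquiv] using norm_le_pi_norm ((finTwoArrowEquiv ℤ).symm q) 1)
  rw [key, Nat.cast_max, Int.norm_eq_abs, Int.norm_eq_abs, Nat.cast_natAbs, Nat.cast_natAbs]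
  push_cast
  rfl

theorem exists_slope_of_hasDerivWithinAt_Icc {a b x y : ℝ} {g g' : ℝ → ℝ}
    (hg : ∀ x ∈ Icc a b, HasDerivWithinAt g (g' x) (Icc a b) x)
    (hx : x ∈ Icc a b) (hy : y ∈ Icc a b) (hxy : x < y) :
    ∃ z ∈ Ioo x y, g y - g x = g' z * (y - x) := by
  have hsub : Icc x y ⊆ Icc a b := Icc_subset_Icc hx.1 hy.2
  obtain ⟨z, hz, h⟩ := exists_hasDerivAt_eq_slope g g' hxy
    (fun z hz => (hg z (hsub hz)).continuousWithinAt.mono hsub)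
    (fun z hz => (hg z (hsub (Ioo_subset_Icc_self hz))).hasDerivAt
      (Icc_mem_nhds (hx.1.trans_lt hz.1) (hz.2.trans_le hy.2)))
  refine ⟨z, hz, ?_⟩
  rw [h, div_mul_cancel₀ _ (sub_pos.2 hxy).ne']

theorem mul_sub_le_abs_sub_of_le_abs_deriv {a b K x y : ℝ} {g g' : ℝ → ℝ}
    (hg : ∀ x ∈ Icc a b, HasDerivWithinAt g (g' x) (Icc a b) x)
    (hK : ∀ x ∈ Icc a b, K < |g' x|)
    (hx : x ∈ Icc a b) (hy : y ∈ Icc a b) : K * |y - x| ≤ |g y - g x| := by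
  wlog hxy : x ≤ y generalizing x y
  · rw [abs_sub_comm y, abs_sub_comm (g y)]
    exact this hy hx (le_of_not_ge hxy)
  rcases hxy.eq_or_lt with rfl | hxy
  · simp
  obtain ⟨z, hz, h⟩ := exists_slope_of_hasDerivWithinAt_Icc hg hx hy hxy
  rw [h, abs_mul]
  gcongr
  exact (hK z ⟨hx.1.trans hz.1.le, hz.2.le.trans hy.2⟩).le

theorem exists_slope_mem_uIcc {a b K x y : ℝ} {g g' g'' : ℝ → ℝ}
    (hg : ∀ x ∈ Icc a b, HasDerivWithinAt g (g' x) (Icc a b) x)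
    (hg' : ∀ x ∈ Icc a b, HasDerivWithinAt g' (g'' x) (Icc a b) x)
    (hK0 : 0 < K) (hK : ∀ x ∈ Icc a b, K < |g'' x|)
    (hx : x ∈ Icc a b) (hy : y ∈ Icc a b) :
    ∃ d ∈ uIcc (g' x) (g' y), g y - g x = d * (y - x) := by
  wlog hxy : x ≤ y generalizing x y
  · obtain ⟨d, hd, h⟩ := this hy hx (le_of_not_ge hxy)
    exact ⟨d, uIcc_comm (g' y) (g' x) ▸ hd, by linarith⟩
  rcases hxy.eq_or_lt with rfl | hxy
  · exact ⟨g' x, left_mem_uIcc, by simp⟩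
  obtain ⟨z, hz, h⟩ := exists_slope_of_hasDerivWithinAt_Icc hg hx hy hxy
  refine ⟨g' z, ?_, h⟩
  have hzI : z ∈ Icc a b := ⟨hx.1.trans hz.1.le, hz.2.le.trans hy.2⟩
  have hinj : InjOn g' (Icc a b) := fun u hu w hw huw => by
    have := mul_sub_le_abs_sub_of_le_abs_deriv hg' hK hu hw
    rw [huw, sub_self, abs_zero] at this
    have h0 : |w - u| = 0 := le_antisymm (by by_contra! h; nlinarith) (abs_nonneg _)
    exact (sub_eq_zero.1 (abs_eq_zero.1 h0)).symm
  rcases ContinuousOn.strictMonoOn_of_injOn_Icc' (hx.1.trans hx.2)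
    (fun u hu => (hg' u hu).continuousWithinAt) hinj with hm | hm
  · exact mem_uIcc_of_le (hm hx hzI hz.1).le (hm hzI hy hz.2).le
  · exact mem_uIcc_of_ge (hm hzI hy hz.2).le (hm hx hzI hz.1).le

/-- For fixed `g`, the pieces on which a translate `n + g` is small while `g'` has a given sign and
size are short, and few of them are nonempty. -/
theorem tsum_ediam_rpow_le {a b K A c D s σ : ℝ} {g g' g'' : ℝ → ℝ}
    (hg : ∀ x ∈ Icc a b, HasDerivWithinAt g (g' x) (Icc a b) x)
    (hg' : ∀ x ∈ Icc a b, HasDerivWithinAt g' (g'' x) (Icc a b) x)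
    (hK0 : 0 < K) (hK : ∀ x ∈ Icc a b, K < |g'' x|)
    (hA : A ≤ 1) (hc : 0 < c) (hs : 0 < s) (hσ : |σ| = 1) :
    ∑' n : ℤ, Metric.ediam {x ∈ Icc a b | |n + g x| < A ∧ c < σ * g' x ∧ |g' x| ≤ D} ^ s ≤
      ENNReal.ofReal ((5 + 4 * (D ^ 2 / K)) * (2 * A / c) ^ s) := by
  set S : ℤ → Set ℝ := fun n => {x ∈ Icc a b | |n + g x| < A ∧ c < σ * g' x ∧ |g' x| ≤ D}
  by_cases hne : ∃ n, (S n).Nonempty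
  swap
  · push Not at hne
    calc ∑' n, Metric.ediam (S n) ^ s = 0 := by simp [hne, hs]
      _ ≤ _ := zero_le
  obtain ⟨n₀, x₀, hx₀, hA₀, hc₀, hD₀⟩ := hne
  have hA0 : 0 < A := (abs_nonneg _).trans_lt hA₀
  have hD : 0 ≤ D := (abs_nonneg _).trans hD₀
  have hdiam : ∀ n, Metric.ediam (S n) ≤ ENNReal.ofReal (2 * A / c) := by
    intro n
    refine Metric.ediam_le fun x ⟨hx, hAx, hcx, _⟩ y ⟨hy, hAy, hcy, _⟩ => ?_
    rw [edist_dist]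
    apply ENNReal.ofReal_le_ofReal
    rw [Real.dist_eq, le_div_iff₀ hc, mul_comm]
    obtain ⟨d, hd, h⟩ := exists_slope_mem_uIcc hg hg' hK0 hK hx hy
    have hcd : c ≤ |d| := by
      rw [← one_mul |d|, ← hσ, ← abs_mul]
      refine le_trans ?_ (le_abs_self _)
      rcases (abs_eq zero_le_one).1 hσ with rfl | rfl <;>
        rcases mem_uIcc.1 hd with hd | hd <;> linarith [hd.1, hd.2]
    calc c * |x - y| ≤ |d| * |y - x| := by rw [abs_sub_comm]; gcongr
      _ = |g y - g x| := by rw [h, abs_mul]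
      _ ≤ 2 * A := by
        rw [abs_le]; rw [abs_lt] at hAx hAy
        constructor <;> linarith [hAx.1, hAx.2, hAy.1, hAy.2]
  set M : ℤ := ⌊2 + 2 * (D ^ 2 / K)⌋
  have hM0 : 0 ≤ M := Int.floor_nonneg.2 (by positivity)
  have hcount : ∀ n ∉ Finset.Icc (n₀ - M) (n₀ + M), Metric.ediam (S n) ^ s = 0 := by
    intro n hn
    suffices S n = ∅ by simp [this, hs]
    by_contra hS
    obtain ⟨x, hx, hAx, hcx, hDx⟩ := nonempty_iff_ne_empty.2 hS
    apply hn
    obtain ⟨d, hd, h⟩ := exists_slope_mem_uIcc hg hg' hK0 hK hx₀ hx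
    have hdD : |d| ≤ D := by
      rw [abs_le] at hD₀ hDx ⊢
      rcases mem_uIcc.1 hd with hd | hd <;> constructor <;> linarith [hd.1, hd.2]
    have hlen : |x - x₀| ≤ 2 * D / K := by
      rw [le_div_iff₀ hK0, mul_comm]
      refine (mul_sub_le_abs_sub_of_le_abs_deriv hg' hK hx₀ hx).trans ?_
      exact (abs_sub _ _).trans (by linarith)
    have hvar : |g x - g x₀| ≤ 2 * (D ^ 2 / K) := by
      rw [h, abs_mul]
      calc |d| * |x - x₀| ≤ D * (2 * D / K) := by gcongr
        _ = _ := by ring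
    have hn₀ : |((n - n₀ : ℤ) : ℝ)| ≤ 2 + 2 * (D ^ 2 / K) := by
      push_cast
      rw [abs_lt] at hA₀ hAx
      rw [abs_le] at hvar ⊢
      constructor <;> linarith [hA₀.1, hA₀.2, hAx.1, hAx.2, hvar.1, hvar.2]
    have hfl : |n - n₀| ≤ M := Int.le_floor.2 (by exact_mod_cast hn₀)
    rw [abs_le] at hfl
    rw [Finset.mem_Icc]
    constructor <;> linarith [hfl.1, hfl.2]
  rw [tsum_eq_sum hcount]
  calc ∑ n ∈ Finset.Icc (n₀ - M) (n₀ + M), Metric.ediam (S n) ^ s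
      ≤ ∑ n ∈ Finset.Icc (n₀ - M) (n₀ + M), ENNReal.ofReal (2 * A / c) ^ s := by
        gcongr; exact hdiam _
    _ = ENNReal.ofReal (2 * M + 1) * ENNReal.ofReal ((2 * A / c) ^ s) := by
        rw [Finset.sum_const, Int.card_Icc, nsmul_eq_mul,
          ENNReal.ofReal_rpow_of_nonneg (by positivity) hs.le]
        congr 1
        have : (2 * M + 1 : ℝ) = (((n₀ + M + 1 - (n₀ - M)).toNat : ℕ) : ℝ) := by
          rw [← Int.cast_natCast, Int.toNat_of_nonneg (by linarith)]
          push_cast; ring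
        rw [this, ENNReal.ofReal_natCast]
    _ ≤ _ := by
        rw [← ENNReal.ofReal_mul (by positivity)]
        apply ENNReal.ofReal_le_ofReal
        have hM : (M : ℝ) ≤ 2 + 2 * (D ^ 2 / K) := Int.floor_le _
        refine mul_le_mul_of_nonneg_right ?_ (by positivity)
        linarith

theorem pieces_count_mul_rpow_le {h v τ ε s p C : ℝ} (hh : 1 ≤ h) (hC : 0 < C) (hs1 : s ≤ 1)
    (h₁ : p ≤ (v + τ) * s) (h₂ : p ≤ (v + τ) * s - (2 * (τ + ε) - 1)) :
    (5 + 4 * ((h ^ (τ + ε)) ^ 2 / (C * h))) * (2 * h ^ (-v) / h ^ τ) ^ s ≤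
      (10 + 8 / C) * h ^ (-p) := by
  have h0 : 0 < h := by linarith
  have e₁ : (h ^ (τ + ε)) ^ 2 / (C * h) = h ^ (2 * (τ + ε) - 1) / C := by
    rw [Real.rpow_sub h0, Real.rpow_one, mul_comm 2 (τ + ε), Real.rpow_mul h0.le]
    norm_cast
    field_simp
  have e₂ : (2 * h ^ (-v) / h ^ τ) ^ s = 2 ^ s * h ^ (-((v + τ) * s)) := by
    rw [mul_div_assoc, ← Real.rpow_sub h0, Real.mul_rpow (by norm_num) (by positivity),
      ← Real.rpow_mul h0.le]
    congr 2
    ring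
  have b₁ : h ^ (-((v + τ) * s)) ≤ h ^ (-p) := Real.rpow_le_rpow_of_exponent_le hh (by linarith)
  have b₂ : h ^ (2 * (τ + ε) - 1) * h ^ (-((v + τ) * s)) ≤ h ^ (-p) := by
    rw [← Real.rpow_add h0]
    exact Real.rpow_le_rpow_of_exponent_le hh (by linarith)
  have b₃ : (2 : ℝ) ^ s ≤ 2 := by
    simpa using Real.rpow_le_rpow_of_exponent_le (x := 2) one_le_two hs1
  rw [e₁, e₂]
  calc (5 + 4 * (h ^ (2 * (τ + ε) - 1) / C)) * (2 ^ s * h ^ (-((v + τ) * s)))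
      = 2 ^ s * (5 * h ^ (-((v + τ) * s)) +
          4 / C * (h ^ (2 * (τ + ε) - 1) * h ^ (-((v + τ) * s)))) := by ring
    _ ≤ 2 * (5 * h ^ (-p) + 4 / C * h ^ (-p)) := by gcongr
    _ = _ := by ring

theorem exists_nat_rpow_mem_Ioc {h y e₀ ε : ℝ} {N : ℕ} (h₀ : h ^ e₀ < y)
    (hN : y ≤ h ^ (e₀ + N * ε)) :
    ∃ k : Fin N, h ^ (e₀ + k * ε) < y ∧ y ≤ h ^ (e₀ + k * ε + ε) := by
  classical
  have hex : ∃ n : ℕ, y ≤ h ^ (e₀ + n * ε) := ⟨N, hN⟩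
  obtain ⟨k, hk⟩ : ∃ k, Nat.find hex = k + 1 := Nat.exists_eq_succ_of_ne_zero fun h0 => by
    have := Nat.find_spec hex
    rw [h0] at this
    simp only [Nat.cast_zero, zero_mul, add_zero] at this
    linarith
  have hspec := Nat.find_spec hex
  rw [hk] at hspec
  have hkN : k < N := by
    have := Nat.find_min' hex hN
    omega
  refine ⟨⟨k, hkN⟩, not_le.1 (Nat.find_min hex (hk ▸ k.lt_succ_self)), hspec.trans_eq ?_⟩
  push_cast
  ring_nf

theorem finite_setOf_abs_lt_one (x y z R : ℝ) :
    {t : ℤ × ℤ × ℤ | |(t.1 : ℝ) + t.2.1 * x + t.2.2 * y + z| < 1 ∧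
      ((max t.2.1.natAbs t.2.2.natAbs : ℕ) : ℝ) < R}.Finite := by
  set M : ℤ := ⌈R * (|x| + |y| + 1) + |z| + 1⌉
  have hM : R * (|x| + |y| + 1) + |z| + 1 ≤ M := Int.le_ceil _
  refine ((finite_Icc (-M) M).prod ((finite_Icc (-M) M).prod (finite_Icc (-M) M))).subset ?_
  rintro ⟨p, q, r⟩ ⟨h₁, h₂⟩
  simp only [Nat.cast_max, Nat.cast_natAbs, Int.cast_abs, max_lt_iff] at h₁ h₂
  have hR : 0 < R := (abs_nonneg _).trans_lt h₂.1
  have hx : |(q : ℝ) * x| ≤ R * |x| := by rw [abs_mul]; gcongr; exact h₂.1.le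
  have hy : |(r : ℝ) * y| ≤ R * |y| := by rw [abs_mul]; gcongr; exact h₂.2.le
  have hx0 := mul_nonneg hR.le (abs_nonneg x)
  have hy0 := mul_nonneg hR.le (abs_nonneg y)
  have hz0 := abs_nonneg z
  have hp : |(p : ℝ)| ≤ M := by
    have hz := abs_le.1 (le_refl |z|)
    rw [abs_lt] at h₁
    rw [abs_le] at hx hy ⊢
    constructor <;> linarith [h₁.1, h₁.2, hx.1, hx.2, hy.1, hy.2, hz.1, hz.2]
  have hq : |(q : ℝ)| ≤ M := by linarith [h₂.1]
  have hr : |(r : ℝ)| ≤ M := by linarith [h₂.2]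
  norm_cast at hp hq hr
  rw [abs_le] at hp hq hr
  exact ⟨hp, hq, hr⟩

theorem ContDiffOn.hasDerivWithinAt_two {f : ℝ → ℝ} {s : Set ℝ} (hf : ContDiffOn ℝ 2 f s)
    (hs : UniqueDiffOn ℝ s) {x : ℝ} (hx : x ∈ s) :
    HasDerivWithinAt f (derivWithin f s x) s x ∧
      HasDerivWithinAt (derivWithin f s) (iteratedDerivWithin 2 f s x) s x := by
  refine ⟨((hf.differentiableOn (by norm_num)) x hx).hasDerivWithinAt, ?_⟩
  have h1 : ContDiffOn ℝ 1 (derivWithin f s) s := hf.derivWithin hs (by norm_num)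
  rw [iteratedDerivWithin_succ, iteratedDerivWithin_one]
  exact ((h1.differentiableOn (by norm_num)) x hx).hasDerivWithinAt

theorem stmt_17 (a b : ℝ) (hab : a < b)
    (f lam : ℝ → ℝ)
    (hf : ContDiffOn ℝ 2 f (Icc a b)) (hlam : ContDiffOn ℝ 2 lam (Icc a b))
    (c₁ c₂ : ℝ) (hc₁ : 0 < c₁)
    (hf'' : ∀ x ∈ Icc a b, c₁ ≤ |iteratedDerivWithin 2 f (Icc a b) x| ∧
      |iteratedDerivWithin 2 f (Icc a b) x| ≤ c₂)
    (v δ : ℝ) (hv : 2 < v) (hδ0 : 0 < δ) (hδ1 : δ ≤ 1)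
    (C₁ H₀ : ℝ) (hC₁ : 0 < C₁)
    (halt : ∀ a₀ a₁ a₂ : ℤ, ¬(a₀ = 0 ∧ a₁ = 0 ∧ a₂ = 0) →
      H₀ ≤ ((max a₁.natAbs a₂.natAbs : ℕ) : ℝ) →
      (∀ x ∈ Icc a b,
          C₁ * ((max a₁.natAbs a₂.natAbs : ℕ) : ℝ) <
            |(a₁ : ℝ) + (a₂ : ℝ) * derivWithin f (Icc a b) x +
              derivWithin lam (Icc a b) x|) ∨
      (∀ x ∈ Icc a b,
          C₁ * ((max a₁.natAbs a₂.natAbs : ℕ) : ℝ) <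
            |(a₂ : ℝ) * iteratedDerivWithin 2 f (Icc a b) x +
              iteratedDerivWithin 2 lam (Icc a b) x|)) :
    dimH {x ∈ Icc a b |
        {t : ℤ × ℤ × ℤ | 1 ≤ (max t.2.1.natAbs t.2.2.natAbs : ℕ) ∧
          |(t.1 : ℝ) + (t.2.1 : ℝ) * x + (t.2.2 : ℝ) * f x + lam x| <
            ((max t.2.1.natAbs t.2.2.natAbs : ℕ) : ℝ) ^ (-v) ∧
          ((max t.2.1.natAbs t.2.2.natAbs : ℕ) : ℝ) ^ (1 - (v + 1) * δ / 3) <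
            |(t.2.1 : ℝ) + (t.2.2 : ℝ) * derivWithin f (Icc a b) x +
              derivWithin lam (Icc a b) x| ∧
          |(t.2.1 : ℝ) + (t.2.2 : ℝ) * derivWithin f (Icc a b) x +
              derivWithin lam (Icc a b) x| ≤
            ((max t.2.1.natAbs t.2.2.natAbs : ℕ) : ℝ) ^ (1 - δ)}.Infinite} ≤
      ENNReal.ofReal (3 / (v + 1)) := by
  refine le_of_not_gt fun hlt => ?_
  have hv1 : 0 < v + 1 := by linarith
  have hlt1 : ENNReal.ofReal (3 / (v + 1)) < 1 := by
    rw [ENNReal.ofReal_lt_one, div_lt_one hv1]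
    linarith
  obtain ⟨s, hs, hs'⟩ := ENNReal.lt_iff_exists_nnreal_btwn.1 (lt_min hlt hlt1)
  refine absurd (hs'.trans_le (min_le_left _ _)) (not_lt.2 ?_)
  have hs1 : (s : ℝ) < 1 := by exact_mod_cast hs'.trans_le (min_le_right _ _)
  have hs3 : 3 / (v + 1) < (s : ℝ) := by
    rw [← ENNReal.ofReal_coe_nnreal] at hs
    exact (ENNReal.ofReal_lt_ofReal_iff'.1 hs).1
  have hs0 : (0 : ℝ) < s := (div_pos three_pos hv1).trans hs3
  set m : ℝ := s * (v + 1) - 3 with hm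
  have hm0 : 0 < m := sub_pos.2 ((div_lt_iff₀ hv1).1 hs3)
  set e₀ : ℝ := 1 - (v + 1) * δ / 3 with he₀
  set e₁ : ℝ := 1 - δ with he₁
  have he : 0 ≤ e₁ - e₀ := by
    have : δ * 3 ≤ (v + 1) * δ := by nlinarith
    linarith
  obtain ⟨N, hN0, hN⟩ : ∃ N : ℕ, 0 < N ∧ (e₁ - e₀) / N ≤ m / 4 := by
    obtain ⟨N, hN⟩ := exists_nat_gt ((e₁ - e₀) / (m / 4))
    have hN' : (0 : ℝ) < N := lt_of_le_of_lt (by positivity) hN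
    refine ⟨N, by exact_mod_cast hN', ?_⟩
    rw [div_le_iff₀ hN']
    rw [div_lt_iff₀ (by positivity)] at hN
    linarith
  have hN' : (0 : ℝ) < N := by exact_mod_cast hN0
  set ε : ℝ := (e₁ - e₀) / N with hε
  have hε0 : 0 ≤ ε := by positivity
  have hNε : e₀ + N * ε = e₁ := by rw [hε]; field_simp; ring
  obtain ⟨H₁, hH₁⟩ : ∃ H₁ : ℝ, ∀ h ≥ H₁, 1 ≤ h ∧ H₀ ≤ h ∧ h ^ e₁ ≤ C₁ * h := by
    have h1 := (tendsto_rpow_neg_atTop hδ0).eventually (ge_mem_nhds hC₁)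
    refine eventually_atTop.1 ?_
    filter_upwards [h1, eventually_ge_atTop 1, eventually_ge_atTop H₀] with h hh h1 h0
    refine ⟨h1, h0, ?_⟩
    have hpos : 0 < h := by linarith
    rw [he₁, sub_eq_neg_add, Real.rpow_add hpos, Real.rpow_one]
    gcongr
  set ht : ℤ × ℤ → ℝ := fun q => ((max q.1.natAbs q.2.natAbs : ℕ) : ℝ) with hht
  set sg : Bool → ℝ := fun i => cond i 1 (-1) with hsg
  set g : ℤ × ℤ → ℝ → ℝ := fun q x => q.1 * x + q.2 * f x + lam x with hg
  set g' : ℤ × ℤ → ℝ → ℝ := fun q x =>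
    q.1 + q.2 * derivWithin f (Icc a b) x + derivWithin lam (Icc a b) x with hg'
  have hu := uniqueDiffOn_Icc hab
  have dg : ∀ q, ∀ x ∈ Icc a b, HasDerivWithinAt (g q) (g' q x) (Icc a b) x := by
    intro q x hx
    have := (((hasDerivWithinAt_id x (Icc a b)).const_mul (q.1 : ℝ)).add
      ((hf.hasDerivWithinAt_two hu hx).1.const_mul (q.2 : ℝ))).add
      (hlam.hasDerivWithinAt_two hu hx).1
    rw [mul_one] at this
    exact this
  have dg' : ∀ q : ℤ × ℤ, ∀ x ∈ Icc a b, HasDerivWithinAt (g' q)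
      (q.2 * iteratedDerivWithin 2 f (Icc a b) x + iteratedDerivWithin 2 lam (Icc a b) x)
      (Icc a b) x := by
    intro q x hx
    exact (((hf.hasDerivWithinAt_two hu hx).2.const_mul (q.2 : ℝ)).const_add (q.1 : ℝ)).add
      (hlam.hasDerivWithinAt_two hu hx).2
  set S : (ℤ × ℤ) × (Fin N × Bool) × ℤ → Set ℝ := fun i =>
    {x | H₁ ≤ ht i.1 ∧ x ∈ {x ∈ Icc a b | |i.2.2 + g i.1 x| < ht i.1 ^ (-v) ∧
      ht i.1 ^ (e₀ + i.2.1.1 * ε) < sg i.2.1.2 * g' i.1 x ∧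
      |g' i.1 x| ≤ ht i.1 ^ (e₀ + i.2.1.1 * ε + ε)}} with hS
  have hsum : ∀ q k, ∑' n, Metric.ediam (S (q, k, n)) ^ (s : ℝ) ≤
      ENNReal.ofReal (10 + 8 / C₁) * ENNReal.ofReal (ht q ^ (-(2 + m / 2))) := by
    intro q k
    by_cases hne : ∃ n, (S (q, k, n)).Nonempty
    swap
    · push Not at hne
      calc ∑' n, Metric.ediam (S (q, k, n)) ^ (s : ℝ) = 0 := by simp [hne, hs0]
        _ ≤ _ := zero_le
    obtain ⟨n, x, hH, hx, -, hx₂, hx₃⟩ := hne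
    dsimp only at hH hx₂ hx₃
    obtain ⟨hq1, hq0, hqe⟩ := hH₁ _ hH
    have hqpos : 0 < ht q := by linarith
    have hk : (k.1 : ℝ) * ε + ε ≤ N * ε := by
      have : ((k.1 : ℕ) : ℝ) + 1 ≤ N := by exact_mod_cast k.1.2
      nlinarith
    have hk0 : 0 ≤ (k.1 : ℝ) * ε := by positivity
    have hK : ∀ x ∈ Icc a b, C₁ * ht q <
        |q.2 * iteratedDerivWithin 2 f (Icc a b) x + iteratedDerivWithin 2 lam (Icc a b) x| := by
      refine (halt 0 q.1 q.2 ?_ hq0).resolve_left fun h => ?_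
      · rintro ⟨-, h1, h2⟩
        simp [hht, h1, h2] at hqpos
      · refine absurd (h x hx) (not_lt.2 (hx₃.trans (le_trans ?_ hqe)))
        exact Real.rpow_le_rpow_of_exponent_le hq1 (by linarith)
    have hsub : ∀ n, S (q, k, n) ⊆ {x ∈ Icc a b | |n + g q x| < ht q ^ (-v) ∧
        ht q ^ (e₀ + k.1 * ε) < sg k.2 * g' q x ∧ |g' q x| ≤ ht q ^ (e₀ + k.1 * ε + ε)} :=
      fun n x hx => hx.2
    have h₁ : 2 + m / 2 ≤ (v + (e₀ + k.1 * ε)) * s := by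
      have h3 : (v + e₀) * s = (m + 3) * (1 - δ / 3) := by rw [hm, he₀]; ring
      nlinarith [mul_nonneg hk0 hs0.le]
    have h₂ : 2 + m / 2 ≤ (v + (e₀ + k.1 * ε)) * s - (2 * (e₀ + k.1 * ε + ε) - 1) := by
      have h4 : (2 - s) * (e₀ + k.1 * ε) ≤ (2 - s) * e₁ := by
        gcongr <;> linarith
      have h5 : v * s - (2 - s) * e₁ = m + 1 + δ * (2 - s) := by rw [hm, he₁]; ring
      nlinarith
    calc ∑' n, Metric.ediam (S (q, k, n)) ^ (s : ℝ)
        ≤ _ := ENNReal.tsum_le_tsum fun n =>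
          ENNReal.rpow_le_rpow (Metric.ediam_mono (hsub n)) hs0.le
      _ ≤ _ := tsum_ediam_rpow_le (dg q) (dg' q) (mul_pos hC₁ hqpos) hK
          (Real.rpow_le_one_of_one_le_of_nonpos hq1 (by linarith))
          (Real.rpow_pos_of_pos hqpos _) hs0 (by cases k.2 <;> simp [hsg])
      _ ≤ _ := by
          rw [← ENNReal.ofReal_mul (by positivity)]
          exact ENNReal.ofReal_le_ofReal (pieces_count_mul_rpow_le hq1 hC₁ hs1.le h₁ h₂)
  have hfin : ∑' i, Metric.ediam (S i) ^ (s : ℝ) ≠ ⊤ := by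
    rw [ENNReal.tsum_prod' (f := fun i => Metric.ediam (S i) ^ (s : ℝ))]
    refine ne_top_of_le_ne_top ?_ (ENNReal.tsum_le_tsum fun q =>
      (ENNReal.tsum_prod' (f := fun i => Metric.ediam (S (q, i)) ^ (s : ℝ))).trans_le
        (ENNReal.tsum_le_tsum fun k => hsum q k))
    simp only [tsum_fintype, Finset.sum_const, nsmul_eq_mul, ENNReal.tsum_mul_left]
    exact ENNReal.mul_ne_top (ENNReal.natCast_ne_top _) (ENNReal.mul_ne_top ENNReal.ofReal_ne_top
      (tsum_max_natAbs_rpow_ne_top (by linarith)))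
  refine (dimH_mono ?_).trans (dimH_setOf_infinite_le S (NNReal.coe_pos.1 hs0) hfin)
  rintro x ⟨hx, hinf⟩
  refine Infinite.of_image (fun i => (i.2.2, i.1.1, i.1.2))
    ((hinf.sdiff (finite_setOf_abs_lt_one x (f x) (lam x) H₁)).mono ?_)
  rintro ⟨n, p, r⟩ ⟨⟨h1, h2, h3, h4⟩, h5⟩
  have hH1 : (1 : ℝ) ≤ ht (p, r) := Nat.one_le_cast.2 h1
  have hH : H₁ ≤ ht (p, r) := by
    by_contra! hlt
    exact h5 ⟨h2.trans_le (Real.rpow_le_one_of_one_le_of_nonpos hH1 (by linarith)), hlt⟩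
  obtain ⟨k, hk, hk'⟩ := exists_nat_rpow_mem_Ioc (N := N) (ε := ε) h3 (by rw [hNε]; exact h4)
  have h2' : |n + g (p, r) x| < ht (p, r) ^ (-v) := by
    simpa only [hg, hht, add_assoc] using h2
  obtain ⟨σ, hσ⟩ : ∃ σ, sg σ * g' (p, r) x = |g' (p, r) x| := by
    rcases le_total 0 (g' (p, r) x) with h | h
    · exact ⟨true, by simp [hsg, abs_of_nonneg h]⟩
    · exact ⟨false, by simp [hsg, abs_of_nonpos h]⟩
  exact ⟨((p, r), (k, σ), n), ⟨hH, hx, h2', hk.trans_eq hσ.symm, hk'⟩, rfl⟩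
end

section
/- Let I ⊂ ℝ be a compact interval, f, λ ∈ C²(I) with 0 < c₁ ≤ |f''(x)| ≤ c₂ for all x ∈ I, let v > 2 and ε > 0. Assume additionally there is a constant C₁ > 0 such that for every (a₀,a₁,a₂) ∈ ℤ³ not all zero with H := max(|a₁|,|a₂|) sufficiently large, either |a₁+a₂f'(x)+λ'(x)| > C₁H for all x ∈ I or |a₂f''(x)+λ''(x)| > C₁H for all x ∈ I. Let A₂^(2) be the set of x ∈ I such that for infinitely many (a₀,a₁,a₂) ∈ ℤ³ with H ≥ 1 one has |a₀+a₁x+a₂f(x)+λ(x)| < H^{−v} and H^{(2−v)/3} < |a₁+a₂f'(x)+λ'(x)| ≤ H^{1−ε}. Then the Hausdorff dimension of A₂^(2) is at most 3/(v+1). -/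
open MeasureTheory Filter Set

open scoped ENNReal NNReal Topology

/-- The Hausdorff–Cantelli lemma. -/
theorem dimH_setOf_infinite_mem_le {X ι : Type*} [EMetricSpace X] [Countable ι]
    (E : ι → Set X) {s : ℝ≥0} (hs : 0 < s) (hE : ∑' i, Metric.ediam (E i) ^ (s : ℝ) ≠ ∞) :
    dimH {x | {i | x ∈ E i}.Infinite} ≤ s := by
  borelize X
  refine dimH_le_of_hausdorffMeasure_ne_top ?_
  have hs' : (0 : ℝ) < s := hs
  have htail := ENNReal.tendsto_tsum_compl_atTop_zero hE
  have hr : Tendsto (fun F : Finset ι =>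
      (∑' i : {i // i ∉ F}, Metric.ediam (E i) ^ (s : ℝ)) ^ (1 / (s : ℝ))) atTop (𝓝 0) := by
    have := (ENNReal.continuous_rpow_const (y := 1 / (s : ℝ))).tendsto 0 |>.comp htail
    rwa [ENNReal.zero_rpow_of_pos (by positivity)] at this
  have key := Measure.hausdorffMeasure_le_liminf_tsum (s : ℝ)
    {x | {i | x ∈ E i}.Infinite} _ hr (fun F (i : {i // i ∉ F}) => E i)
    (Eventually.of_forall fun F i => by
      rw [one_div, ENNReal.le_rpow_inv_iff hs']
      exact ENNReal.le_tsum (f := fun i : {i // i ∉ F} => Metric.ediam (E i) ^ (s : ℝ)) i)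
    (Eventually.of_forall fun F x hx => by
      obtain ⟨i, hi, hiF⟩ := Set.Infinite.exists_notMem_finset hx F
      exact mem_iUnion.2 ⟨⟨i, hiF⟩, hi⟩)
  rw [htail.liminf_eq] at key
  exact ne_top_of_le_ne_top ENNReal.zero_ne_top key

theorem exists_mem_Icc_sub_eq_mul {a b : ℝ} {F g : ℝ → ℝ}
    (hF : ∀ x ∈ Icc a b, HasDerivWithinAt F (g x) (Icc a b) x)
    {x y : ℝ} (hx : x ∈ Icc a b) (hy : y ∈ Icc a b) (hxy : x ≤ y) :
    ∃ ξ ∈ Icc x y, F y - F x = g ξ * (y - x) := by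
  rcases hxy.eq_or_lt with rfl | hlt
  · exact ⟨x, by simp, by simp⟩
  have hsub : Icc x y ⊆ Icc a b := Icc_subset_Icc hx.1 hy.2
  obtain ⟨ξ, hξ, h⟩ := exists_hasDerivAt_eq_slope F g hlt
    (fun z hz => (hF z (hsub hz)).continuousWithinAt.mono hsub)
    (fun z hz => (hF z (hsub (Ioo_subset_Icc_self hz))).hasDerivAt
      (Icc_mem_nhds (hx.1.trans_lt hz.1) (hz.2.trans_le hy.2)))
  refine ⟨ξ, Ioo_subset_Icc_self hξ, ?_⟩
  rw [h]
  field_simp [sub_ne_zero.2 hlt.ne']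

theorem mul_sub_le_abs_sub {a b K : ℝ} {g g' : ℝ → ℝ}
    (hg : ∀ x ∈ Icc a b, HasDerivWithinAt g (g' x) (Icc a b) x)
    (hK : ∀ x ∈ Icc a b, K ≤ |g' x|)
    {x y : ℝ} (hx : x ∈ Icc a b) (hy : y ∈ Icc a b) (hxy : x ≤ y) :
    K * (y - x) ≤ |g y - g x| := by
  obtain ⟨ξ, hξ, h⟩ := exists_mem_Icc_sub_eq_mul hg hx hy hxy
  rw [h, abs_mul, abs_of_nonneg (sub_nonneg.2 hxy)]
  exact mul_le_mul_of_nonneg_right (hK ξ (Icc_subset_Icc hx.1 hy.2 hξ)) (sub_nonneg.2 hxy)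

theorem mem_uIcc_of_le_abs_deriv {a b K : ℝ} {g g' : ℝ → ℝ} (hab : a ≤ b) (hKpos : 0 < K)
    (hg : ∀ x ∈ Icc a b, HasDerivWithinAt g (g' x) (Icc a b) x)
    (hK : ∀ x ∈ Icc a b, K ≤ |g' x|)
    {x y ξ : ℝ} (hx : x ∈ Icc a b) (hy : y ∈ Icc a b) (hξ : ξ ∈ Icc x y) :
    g ξ ∈ uIcc (g x) (g y) := by
  have hcont : ContinuousOn g (Icc a b) := fun z hz => (hg z hz).continuousWithinAt
  have hinj : InjOn g (Icc a b) := by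
    intro z hz w hw hzw
    rcases le_total z w with h | h
    · have := mul_sub_le_abs_sub hg hK hz hw h
      rw [hzw, sub_self, abs_zero] at this
      nlinarith
    · have := mul_sub_le_abs_sub hg hK hw hz h
      rw [hzw, sub_self, abs_zero] at this
      nlinarith
  have hξ' : ξ ∈ Icc a b := Icc_subset_Icc hx.1 hy.2 hξ
  rw [mem_uIcc]
  rcases hcont.strictMonoOn_of_injOn_Icc' hab hinj with h | h
  · exact Or.inl ⟨h.monotoneOn hx hξ' hξ.1, h.monotoneOn hξ' hy hξ.2⟩
  · exact Or.inr ⟨h.antitoneOn hξ' hy hξ.2, h.antitoneOn hx hξ' hξ.1⟩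

section NearZeroSet

variable {a b K r δ Δ σ : ℝ} {Φ g g' : ℝ → ℝ}

/-- The points where the translate `n + Φ` is small while `σ * g` (with `g` playing the role of
the derivative of `Φ`) lies in a prescribed range. -/
def nearZeroSet (a b r δ Δ σ : ℝ) (Φ g : ℝ → ℝ) (n : ℤ) : Set ℝ :=
  {x ∈ Icc a b | |n + Φ x| < r ∧ δ < σ * g x ∧ |g x| ≤ Δ}

theorem ediam_nearZeroSet_le (hab : a ≤ b) (hKpos : 0 < K) (hδ : 0 < δ) (hσ : |σ| = 1)
    (hΦ : ∀ x ∈ Icc a b, HasDerivWithinAt Φ (g x) (Icc a b) x)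
    (hg : ∀ x ∈ Icc a b, HasDerivWithinAt g (g' x) (Icc a b) x)
    (hK : ∀ x ∈ Icc a b, K ≤ |g' x|) (n : ℤ) :
    Metric.ediam (nearZeroSet a b r δ Δ σ Φ g n) ≤ ENNReal.ofReal (2 * r / δ) := by
  have main : ∀ x ∈ nearZeroSet a b r δ Δ σ Φ g n, ∀ y ∈ nearZeroSet a b r δ Δ σ Φ g n,
      x ≤ y → edist x y ≤ ENNReal.ofReal (2 * r / δ) := by
    rintro x ⟨hx, hx1, hx2, -⟩ y ⟨hy, hy1, hy2, -⟩ hxy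
    obtain ⟨ξ, hξ, h⟩ := exists_mem_Icc_sub_eq_mul hΦ hx hy hxy
    have hgξ : δ < |g ξ| := by
      have hle : σ * g ξ ≤ |g ξ| := (le_abs_self _).trans (by rw [abs_mul, hσ, one_mul])
      refine lt_of_lt_of_le ?_ hle
      have hs : σ = 1 ∨ σ = -1 := by
        rcases abs_eq (zero_le_one' ℝ) |>.1 hσ with h | h <;> simp [h]
      have := mem_uIcc.1 (mem_uIcc_of_le_abs_deriv hab hKpos hg hK hx hy hξ)
      rcases hs with rfl | rfl <;> rcases this with h | h <;> linarith [h.1, h.2]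
    rw [edist_comm, edist_dist, Real.dist_eq, abs_of_nonneg (sub_nonneg.2 hxy)]
    apply ENNReal.ofReal_le_ofReal
    rw [le_div_iff₀ hδ]
    have h1 : |Φ y - Φ x| ≤ 2 * r := by
      have := abs_sub (n + Φ y) (n + Φ x)
      rw [add_sub_add_left_eq_sub] at this
      linarith
    rw [h, abs_mul, abs_of_nonneg (sub_nonneg.2 hxy)] at h1
    nlinarith [sub_nonneg.2 hxy]
  refine Metric.ediam_le fun x hx y hy => ?_
  rcases le_total x y with h | h
  · exact main x hx y hy h
  · rw [edist_comm]; exact main y hy x hx h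

theorem abs_sub_le_of_nearZeroSet_nonempty (hab : a ≤ b) (hKpos : 0 < K) (hr : r ≤ 1)
    (hΦ : ∀ x ∈ Icc a b, HasDerivWithinAt Φ (g x) (Icc a b) x)
    (hg : ∀ x ∈ Icc a b, HasDerivWithinAt g (g' x) (Icc a b) x)
    (hK : ∀ x ∈ Icc a b, K ≤ |g' x|) {m n : ℤ}
    (hm : (nearZeroSet a b r δ Δ σ Φ g m).Nonempty)
    (hn : (nearZeroSet a b r δ Δ σ Φ g n).Nonempty) :
    |(m : ℝ) - n| ≤ 2 + 2 * Δ ^ 2 / K := by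
  obtain ⟨x, hx, hx1, -, hx3⟩ := hm
  obtain ⟨y, hy, hy1, -, hy3⟩ := hn
  wlog hxy : x ≤ y generalizing x y m n
  · rw [abs_sub_comm]
    exact this y hy hy1 hy3 x hx hx1 hx3 (le_of_not_ge hxy)
  have hΔ : 0 ≤ Δ := (abs_nonneg _).trans hx3
  obtain ⟨ξ, hξ, h⟩ := exists_mem_Icc_sub_eq_mul hΦ hx hy hxy
  have hgξ : |g ξ| ≤ Δ := by
    rw [abs_le] at hx3 hy3 ⊢
    rcases mem_uIcc.1 (mem_uIcc_of_le_abs_deriv hab hKpos hg hK hx hy hξ) with h | h <;>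
      constructor <;> linarith [h.1, h.2]
  have hlen : y - x ≤ 2 * Δ / K := by
    rw [le_div_iff₀ hKpos]
    linarith [mul_sub_le_abs_sub hg hK hx hy hxy, abs_sub (g y) (g x)]
  have hvar : |Φ y - Φ x| ≤ 2 * Δ ^ 2 / K := by
    rw [h, abs_mul, abs_of_nonneg (sub_nonneg.2 hxy)]
    calc |g ξ| * (y - x) ≤ Δ * (2 * Δ / K) :=
          mul_le_mul hgξ hlen (sub_nonneg.2 hxy) hΔ
      _ = 2 * Δ ^ 2 / K := by ring
  rw [abs_le] at hvar ⊢
  rw [abs_lt] at hx1 hy1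
  constructor <;> linarith [hvar.1, hvar.2, hx1.1, hx1.2, hy1.1, hy1.2]

theorem tsum_ediam_nearZeroSet_rpow_le (hab : a ≤ b) (hKpos : 0 < K) (hr₀ : 0 ≤ r) (hr : r ≤ 1)
    (hδ : 0 < δ) (hσ : |σ| = 1)
    (hΦ : ∀ x ∈ Icc a b, HasDerivWithinAt Φ (g x) (Icc a b) x)
    (hg : ∀ x ∈ Icc a b, HasDerivWithinAt g (g' x) (Icc a b) x)
    (hK : ∀ x ∈ Icc a b, K ≤ |g' x|) {s : ℝ} (hs : 0 < s) :
    ∑' n, Metric.ediam (nearZeroSet a b r δ Δ σ Φ g n) ^ s ≤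
      ENNReal.ofReal ((5 + 4 * Δ ^ 2 / K) * (2 * r / δ) ^ s) := by
  by_cases hne : ∃ m, (nearZeroSet a b r δ Δ σ Φ g m).Nonempty
  swap
  · push Not at hne
    simp [hne, hs]
  obtain ⟨m, hm⟩ := hne
  set W : ℝ := 2 + 2 * Δ ^ 2 / K with hW
  have hW₀ : 0 ≤ W := by positivity
  have hsupp : ∀ n ∉ Finset.Icc (m - ⌊W⌋) (m + ⌊W⌋),
      Metric.ediam (nearZeroSet a b r δ Δ σ Φ g n) ^ s = 0 := by
    intro n hn
    rcases (nearZeroSet a b r δ Δ σ Φ g n).eq_empty_or_nonempty with h | h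
    · simp [h, hs]
    refine absurd ?_ hn
    have hmn := abs_sub_le_of_nearZeroSet_nonempty hab hKpos hr hΦ hg hK hm h
    have : |m - n| ≤ ⌊W⌋ := Int.le_floor.2 (by push_cast; exact hmn)
    rw [abs_le] at this
    rw [Finset.mem_Icc]
    omega
  rw [tsum_eq_sum hsupp]
  have hterm : ∀ n ∈ Finset.Icc (m - ⌊W⌋) (m + ⌊W⌋),
      Metric.ediam (nearZeroSet a b r δ Δ σ Φ g n) ^ s ≤ ENNReal.ofReal ((2 * r / δ) ^ s) := by
    intro n _
    rw [← ENNReal.ofReal_rpow_of_nonneg (by positivity) hs.le]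
    exact ENNReal.rpow_le_rpow (ediam_nearZeroSet_le hab hKpos hδ hσ hΦ hg hK n) hs.le
  refine (Finset.sum_le_card_nsmul _ _ _ hterm).trans ?_
  rw [nsmul_eq_mul, ENNReal.ofReal_mul (by positivity)]
  gcongr
  rw [← ENNReal.ofReal_natCast]
  apply ENNReal.ofReal_le_ofReal
  have hfl : 0 ≤ ⌊W⌋ := Int.floor_nonneg.2 hW₀
  have hcard : ((Finset.Icc (m - ⌊W⌋) (m + ⌊W⌋)).card : ℤ) = 2 * ⌊W⌋ + 1 := by
    rw [Int.card_Icc, Int.toNat_of_nonneg (by omega)]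
    ring
  have hcard' : ((Finset.Icc (m - ⌊W⌋) (m + ⌊W⌋)).card : ℝ) = 2 * ⌊W⌋ + 1 := by
    exact_mod_cast hcard
  rw [hcard']
  have h1 := Int.floor_le W
  have h2 : 4 * Δ ^ 2 / K = 2 * (2 * Δ ^ 2 / K) := by ring
  linarith

end NearZeroSet

theorem summable_max_natAbs_rpow {k : ℝ} (hk : 2 < k) :
    Summable fun p : ℤ × ℤ => ((max p.1.natAbs p.2.natAbs : ℕ) : ℝ) ^ (-k) := by
  have h := EisensteinSeries.summable_one_div_norm_rpow hk
  rw [← (finTwoArrowEquiv _).symm.summable_iff] at h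
  refine h.congr fun p => ?_
  simp only [Function.comp_apply, finTwoArrowEquiv_symm_apply]
  congr 1
  rw [EisensteinSeries.norm_eq_max_natAbs]
  simp

theorem covering_cost_le {H C v θ η s : ℝ} (hH : 1 ≤ H) (hC : 0 < C)
    (hθ₀ : (2 - v) / 3 ≤ θ) (hθ₁ : θ ≤ 1) (hs₀ : 0 < s) (hs₂ : s ≤ 2)
    (hs : (v + 1) * s = 3 + 6 * η) :
    (5 + 4 * (H ^ (θ + η)) ^ 2 / (C * H)) * (2 * H ^ (-v) / H ^ θ) ^ s ≤
      (5 + 4 / C) * 2 ^ s * H ^ (-(2 + 4 * η)) := by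
  have hH₀ : 0 < H := by linarith
  have e1 : (H ^ (θ + η)) ^ 2 / (C * H) = C⁻¹ * H ^ (2 * θ + 2 * η - 1) := by
    rw [← Real.rpow_natCast, ← Real.rpow_mul hH₀.le, Real.rpow_sub_one hH₀.ne']
    push_cast
    rw [show (θ + η) * 2 = 2 * θ + 2 * η by ring]
    field_simp
  have e2 : (2 * H ^ (-v) / H ^ θ) ^ s = 2 ^ s * H ^ ((-v - θ) * s) := by
    rw [mul_div_assoc, ← Real.rpow_sub hH₀, Real.mul_rpow (by norm_num) (by positivity),
      ← Real.rpow_mul hH₀.le]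
  have b1 : H ^ ((-v - θ) * s) ≤ H ^ (-(2 + 4 * η)) :=
    Real.rpow_le_rpow_of_exponent_le hH (by nlinarith)
  have b2 : H ^ (2 * θ + 2 * η - 1) * H ^ ((-v - θ) * s) ≤ H ^ (-(2 + 4 * η)) := by
    rw [← Real.rpow_add hH₀]
    exact Real.rpow_le_rpow_of_exponent_le hH (by nlinarith)
  rw [mul_div_assoc, e1, e2]
  calc (5 + 4 * (C⁻¹ * H ^ (2 * θ + 2 * η - 1))) * (2 ^ s * H ^ ((-v - θ) * s))
      = 2 ^ s * (5 * H ^ ((-v - θ) * s) +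
          4 / C * (H ^ (2 * θ + 2 * η - 1) * H ^ ((-v - θ) * s))) := by ring
    _ ≤ 2 ^ s * (5 * H ^ (-(2 + 4 * η)) + 4 / C * H ^ (-(2 + 4 * η))) := by gcongr
    _ = (5 + 4 / C) * 2 ^ s * H ^ (-(2 + 4 * η)) := by ring

theorem exists_rpow_lt_and_le {H y θ₀ η : ℝ} {M : ℕ} (hlow : H ^ θ₀ < y)
    (hup : y ≤ H ^ (θ₀ + M * η)) :
    ∃ i < M, H ^ (θ₀ + i * η) < y ∧ y ≤ H ^ (θ₀ + i * η + η) := by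
  induction M with
  | zero => simp at hup; linarith
  | succ M ih =>
    rcases le_or_gt y (H ^ (θ₀ + M * η)) with h | h
    · obtain ⟨i, hi, h'⟩ := ih h
      exact ⟨i, by omega, h'⟩
    · refine ⟨M, by omega, h, ?_⟩
      convert hup using 2
      push_cast
      ring

theorem finite_setOf_lt_and_abs_lt (H₁ x y z : ℝ) :
    {t : ℤ × ℤ × ℤ | ((max t.2.1.natAbs t.2.2.natAbs : ℕ) : ℝ) < H₁ ∧
      |(t.1 : ℝ) + t.2.1 * x + t.2.2 * y + z| < 1}.Finite := by
  set N : ℤ := ⌈H₁⌉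
  set L : ℤ := ⌈1 + N * |x| + N * |y| + |z|⌉
  refine ((finite_Icc (-L) L).prod ((finite_Icc (-N) N).prod (finite_Icc (-N) N))).subset ?_
  rintro ⟨t, p, q⟩ ⟨h1, h2⟩
  simp only at h1 h2
  have hp : |p| ≤ N := by
    have : ((p.natAbs : ℤ) : ℝ) ≤ N :=
      le_trans (by rw [Int.cast_natCast]; exact Nat.cast_le.2 (le_max_left _ _)) (h1.le.trans (Int.le_ceil _))
    rw [Int.abs_eq_natAbs]
    exact Int.cast_le.1 this
  have hq : |q| ≤ N := by
    have : ((q.natAbs : ℤ) : ℝ) ≤ N :=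
      le_trans (by rw [Int.cast_natCast]; exact Nat.cast_le.2 (le_max_right _ _)) (h1.le.trans (Int.le_ceil _))
    rw [Int.abs_eq_natAbs]
    exact Int.cast_le.1 this
  have hpR : |(p : ℝ)| ≤ N := by exact_mod_cast hp
  have hqR : |(q : ℝ)| ≤ N := by exact_mod_cast hq
  have ht : |t| ≤ L := by
    have : |(t : ℝ)| ≤ L := by
      refine le_trans ?_ (Int.le_ceil _)
      have e : (t : ℝ) = (t + p * x + q * y + z) - p * x - q * y - z := by ring
      have h3 : |p * x| ≤ N * |x| := by rw [abs_mul]; gcongr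
      have h4 : |q * y| ≤ N * |y| := by rw [abs_mul]; gcongr
      rw [e]
      have := abs_sub ((t + p * x + q * y + z) - p * x - q * y) z
      have := abs_sub ((t + p * x + q * y + z) - p * x) (q * y)
      have := abs_sub (t + p * x + q * y + z) (p * x)
      linarith
    exact_mod_cast this
  exact ⟨abs_le.1 ht, abs_le.1 hp, abs_le.1 hq⟩

theorem ContDiffOn.hasDerivWithinAt_Icc {a b : ℝ} (hab : a < b) {F : ℝ → ℝ}
    (hF : ContDiffOn ℝ 2 F (Icc a b)) {x : ℝ} (hx : x ∈ Icc a b) :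
    HasDerivWithinAt F (derivWithin F (Icc a b) x) (Icc a b) x ∧
      HasDerivWithinAt (derivWithin F (Icc a b)) (iteratedDerivWithin 2 F (Icc a b) x)
        (Icc a b) x := by
  refine ⟨(hF.differentiableOn (by norm_num) x hx).hasDerivWithinAt, ?_⟩
  rw [iteratedDerivWithin_succ, iteratedDerivWithin_one]
  have h1 : ContDiffOn ℝ 1 (derivWithin F (Icc a b)) (Icc a b) :=
    hF.derivWithin (uniqueDiffOn_Icc hab) (by norm_num)
  exact (h1.differentiableOn (by norm_num) x hx).hasDerivWithinAt

theorem dimH_le_of_two_alternatives {a b : ℝ} (hab : a ≤ b) {f lam f' lam' f'' lam'' : ℝ → ℝ}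
    (hf : ∀ x ∈ Icc a b, HasDerivWithinAt f (f' x) (Icc a b) x)
    (hlam : ∀ x ∈ Icc a b, HasDerivWithinAt lam (lam' x) (Icc a b) x)
    (hf' : ∀ x ∈ Icc a b, HasDerivWithinAt f' (f'' x) (Icc a b) x)
    (hlam' : ∀ x ∈ Icc a b, HasDerivWithinAt lam' (lam'' x) (Icc a b) x)
    {v ε C₁ H₀ s : ℝ} (hv : 2 < v) (hε : 0 < ε) (hC₁ : 0 < C₁)
    (halt : ∀ a₁ a₂ : ℤ, ¬(a₁ = 0 ∧ a₂ = 0) →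
      H₀ ≤ ((max a₁.natAbs a₂.natAbs : ℕ) : ℝ) →
      (∀ x ∈ Icc a b, C₁ * ((max a₁.natAbs a₂.natAbs : ℕ) : ℝ) <
        |(a₁ : ℝ) + a₂ * f' x + lam' x|) ∨
      (∀ x ∈ Icc a b, C₁ * ((max a₁.natAbs a₂.natAbs : ℕ) : ℝ) < |a₂ * f'' x + lam'' x|))
    (hs : 3 / (v + 1) < s) (hs₂ : s ≤ 2) :
    dimH {x ∈ Icc a b |
        {t : ℤ × ℤ × ℤ | 1 ≤ (max t.2.1.natAbs t.2.2.natAbs : ℕ) ∧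
          |(t.1 : ℝ) + (t.2.1 : ℝ) * x + (t.2.2 : ℝ) * f x + lam x| <
            ((max t.2.1.natAbs t.2.2.natAbs : ℕ) : ℝ) ^ (-v) ∧
          ((max t.2.1.natAbs t.2.2.natAbs : ℕ) : ℝ) ^ ((2 - v) / 3) <
            |(t.2.1 : ℝ) + (t.2.2 : ℝ) * f' x + lam' x| ∧
          |(t.2.1 : ℝ) + (t.2.2 : ℝ) * f' x + lam' x| ≤
            ((max t.2.1.natAbs t.2.2.natAbs : ℕ) : ℝ) ^ (1 - ε)}.Infinite} ≤
      ENNReal.ofReal s := by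
  have hs₀ : 0 < s := lt_trans (by positivity) hs
  obtain ⟨η, hη, hsη⟩ : ∃ η : ℝ, 0 < η ∧ (v + 1) * s = 3 + 6 * η := by
    rw [div_lt_iff₀ (by linarith)] at hs
    exact ⟨((v + 1) * s - 3) / 6, by linarith, by ring⟩
  obtain ⟨H₁, hH₁⟩ : ∃ H₁ : ℝ, ∀ H ≥ H₁, 1 ≤ H ∧ H₀ ≤ H ∧ H ^ (1 - ε) ≤ C₁ * H := by
    have h0 : ∀ᶠ H : ℝ in atTop, H ^ (-ε) < C₁ :=
      (tendsto_rpow_neg_atTop hε).eventually_lt_const hC₁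
    have h : ∀ᶠ H : ℝ in atTop, 1 ≤ H ∧ H₀ ≤ H ∧ H ^ (1 - ε) ≤ C₁ * H := by
      filter_upwards [h0, eventually_ge_atTop 1, eventually_ge_atTop H₀] with H h1 h2 h3
      refine ⟨h2, h3, ?_⟩
      rw [sub_eq_neg_add, Real.rpow_add_one (by linarith)]
      exact mul_le_mul_of_nonneg_right h1.le (by linarith)
    exact eventually_atTop.1 h
  set θ₀ : ℝ := (2 - v) / 3 with hθ₀
  set M : ℕ := ⌊(1 - θ₀) / η⌋₊ + 1 with hM
  let ht : ℤ × ℤ → ℝ := fun p => ((max p.1.natAbs p.2.natAbs : ℕ) : ℝ)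
  let Φ : ℤ × ℤ → ℝ → ℝ := fun p x => p.1 * x + p.2 * f x + lam x
  let g : ℤ × ℤ → ℝ → ℝ := fun p x => p.1 + p.2 * f' x + lam' x
  let g' : ℤ × ℤ → ℝ → ℝ := fun p x => p.2 * f'' x + lam'' x
  have hΦ : ∀ p, ∀ x ∈ Icc a b, HasDerivWithinAt (Φ p) (g p x) (Icc a b) x := by
    intro p x hx
    have h := (((hasDerivWithinAt_id x (Icc a b)).const_mul (p.1 : ℝ)).add
      ((hf x hx).const_mul (p.2 : ℝ))).add (hlam x hx)
    rw [mul_one] at h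
    exact h
  have hg : ∀ p, ∀ x ∈ Icc a b, HasDerivWithinAt (g p) (g' p x) (Icc a b) x := by
    intro p x hx
    exact (((hf' x hx).const_mul (p.2 : ℝ)).const_add (p.1 : ℝ)).add (hlam' x hx)
  let good : ℤ × ℤ → Prop := fun p => H₁ ≤ ht p ∧ ∀ x ∈ Icc a b, C₁ * ht p < |g' p x|
  let sgn : Bool → ℝ := fun σ => cond σ 1 (-1)
  classical
  let E : ((Fin M × Bool) × ℤ × ℤ) × ℤ → Set ℝ := fun j =>
    if good j.1.2 then
      nearZeroSet a b (ht j.1.2 ^ (-v)) (ht j.1.2 ^ (θ₀ + j.1.1.1 * η))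
        (ht j.1.2 ^ (θ₀ + j.1.1.1 * η + η)) (sgn j.1.1.2) (Φ j.1.2) (g j.1.2) j.2
    else ∅
  have hcost : ∑' j, Metric.ediam (E j) ^ s ≠ ∞ := by
    rw [ENNReal.tsum_prod (f := fun k n => Metric.ediam (E (k, n)) ^ s)]
    rw [ENNReal.tsum_prod (f := fun k p => ∑' n, Metric.ediam (E ((k, p), n)) ^ s)]
    rw [tsum_fintype]
    refine ENNReal.sum_ne_top.2 fun k _ => ?_
    have hbound : ∀ p, ∑' n, Metric.ediam (E ((k, p), n)) ^ s ≤
        ENNReal.ofReal ((5 + 4 / C₁) * 2 ^ s * ht p ^ (-(2 + 4 * η))) := by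
      intro p
      by_cases hp : good p
      · have h1 : 1 ≤ ht p := (hH₁ _ hp.1).1
        have hpos : 0 < ht p := by linarith
        simp only [E, if_pos hp]
        refine (tsum_ediam_nearZeroSet_rpow_le hab (mul_pos hC₁ hpos) (by positivity)
          (Real.rpow_le_one_of_one_le_of_nonpos h1 (by linarith)) (by positivity) ?_
          (hΦ p) (hg p) (fun x hx => (hp.2 x hx).le) hs₀).trans ?_
        · cases k.2 <;> simp [sgn]
        · apply ENNReal.ofReal_le_ofReal
          have hk : ((k.1 : ℕ) : ℝ) * η ≤ 1 - θ₀ := by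
            rw [← le_div_iff₀ hη]
            refine le_trans ?_ (Nat.floor_le (div_nonneg (by linarith) hη.le))
            exact_mod_cast Nat.lt_succ_iff.1 k.1.2
          have : 0 ≤ ((k.1 : ℕ) : ℝ) * η := by positivity
          exact covering_cost_le h1 hC₁ (by linarith) (by linarith) hs₀ hs₂ hsη
      · simp [E, if_neg hp, hs₀]
    refine ne_top_of_le_ne_top ?_ (ENNReal.tsum_le_tsum hbound)
    exact ((summable_max_natAbs_rpow (by linarith)).mul_left _).tsum_ofReal_ne_top
  lift s to ℝ≥0 using hs₀.le
  rw [ENNReal.ofReal_coe_nnreal]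
  refine le_trans (dimH_mono ?_) (dimH_setOf_infinite_mem_le E hs₀ hcost)
  rintro x ⟨hx, hinf⟩
  by_contra hfin
  rw [mem_ofPred_eq, not_infinite] at hfin
  refine hinf (((hfin.image fun j => (j.2, j.1.2)).union
    (finite_setOf_lt_and_abs_lt H₁ x (f x) (lam x))).subset ?_)
  rintro ⟨n, p⟩ ⟨h1, h2, h3, h4⟩
  have h1' : 1 ≤ ht p := Nat.one_le_cast.2 h1
  rcases lt_or_ge (ht p) H₁ with hlt | hge
  · exact Or.inr ⟨hlt, h2.trans_le
      (Real.rpow_le_one_of_one_le_of_nonpos h1' (by linarith))⟩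
  left
  obtain ⟨-, hH₀p, hC⟩ := hH₁ _ hge
  have hgood : good p := by
    refine ⟨hge, (halt p.1 p.2 ?_ hH₀p).resolve_left fun h => ?_⟩
    · rintro ⟨e1, e2⟩
      simp [e1, e2] at h1
    · exact absurd (h x hx) (not_lt.2 (h4.trans hC))
  have hup : |g p x| ≤ ht p ^ (θ₀ + M * η) := by
    refine h4.trans (Real.rpow_le_rpow_of_exponent_le h1' ?_)
    have := Nat.lt_floor_add_one ((1 - θ₀) / η)
    rw [div_lt_iff₀ hη] at this
    rw [hM]
    push_cast
    linarith
  obtain ⟨i, hi, hl, hu⟩ := exists_rpow_lt_and_le h3 hup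
  obtain ⟨σ, hσ⟩ : ∃ σ : Bool, sgn σ * g p x = |g p x| := by
    rcases abs_cases (g p x) with h | h
    · exact ⟨true, by simp [sgn, h.1]⟩
    · exact ⟨false, by simp [sgn, h.1]⟩
  refine ⟨(((⟨i, hi⟩, σ), p), n), ?_, rfl⟩
  simp only [E, mem_ofPred_eq, if_pos hgood]
  refine ⟨hx, ?_, ?_, hu⟩
  · have hsum : (n : ℝ) + Φ p x = n + p.1 * x + p.2 * f x + lam x := by
      simp only [Φ]
      ring
    rw [hsum]
    exact h2
  · rw [hσ]; exact hl

theorem stmt_18 (a b : ℝ) (hab : a < b)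
    (f lam : ℝ → ℝ)
    (hf : ContDiffOn ℝ 2 f (Icc a b)) (hlam : ContDiffOn ℝ 2 lam (Icc a b))
    (c₁ c₂ : ℝ) (hc₁ : 0 < c₁)
    (hf'' : ∀ x ∈ Icc a b, c₁ ≤ |iteratedDerivWithin 2 f (Icc a b) x| ∧
      |iteratedDerivWithin 2 f (Icc a b) x| ≤ c₂)
    (v ε : ℝ) (hv : 2 < v) (hε : 0 < ε)
    (C₁ H₀ : ℝ) (hC₁ : 0 < C₁)
    (halt : ∀ a₀ a₁ a₂ : ℤ, ¬(a₀ = 0 ∧ a₁ = 0 ∧ a₂ = 0) →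
      H₀ ≤ ((max a₁.natAbs a₂.natAbs : ℕ) : ℝ) →
      (∀ x ∈ Icc a b,
          C₁ * ((max a₁.natAbs a₂.natAbs : ℕ) : ℝ) <
            |(a₁ : ℝ) + (a₂ : ℝ) * derivWithin f (Icc a b) x +
              derivWithin lam (Icc a b) x|) ∨
      (∀ x ∈ Icc a b,
          C₁ * ((max a₁.natAbs a₂.natAbs : ℕ) : ℝ) <
            |(a₂ : ℝ) * iteratedDerivWithin 2 f (Icc a b) x +
              iteratedDerivWithin 2 lam (Icc a b) x|)) :
    dimH {x ∈ Icc a b |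
        {t : ℤ × ℤ × ℤ | 1 ≤ (max t.2.1.natAbs t.2.2.natAbs : ℕ) ∧
          |(t.1 : ℝ) + (t.2.1 : ℝ) * x + (t.2.2 : ℝ) * f x + lam x| <
            ((max t.2.1.natAbs t.2.2.natAbs : ℕ) : ℝ) ^ (-v) ∧
          ((max t.2.1.natAbs t.2.2.natAbs : ℕ) : ℝ) ^ ((2 - v) / 3) <
            |(t.2.1 : ℝ) + (t.2.2 : ℝ) * derivWithin f (Icc a b) x +
              derivWithin lam (Icc a b) x| ∧
          |(t.2.1 : ℝ) + (t.2.2 : ℝ) * derivWithin f (Icc a b) x +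
              derivWithin lam (Icc a b) x| ≤
            ((max t.2.1.natAbs t.2.2.natAbs : ℕ) : ℝ) ^ (1 - ε)}.Infinite} ≤
      ENNReal.ofReal (3 / (v + 1)) := by
  refine ge_of_tendsto (ENNReal.continuous_ofReal.tendsto _ |>.mono_left
    (nhdsWithin_le_nhds (s := Ioi (3 / (v + 1))))) ?_
  have hlt : 3 / (v + 1) < 2 := by
    rw [div_lt_iff₀ (by linarith)]
    linarith
  filter_upwards [Ioo_mem_nhdsGT hlt] with s hs
  refine dimH_le_of_two_alternatives hab.le
    (fun x hx => (hf.hasDerivWithinAt_Icc hab hx).1)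
    (fun x hx => (hlam.hasDerivWithinAt_Icc hab hx).1)
    (fun x hx => (hf.hasDerivWithinAt_Icc hab hx).2)
    (fun x hx => (hlam.hasDerivWithinAt_Icc hab hx).2)
    hv hε hC₁ (fun a₁ a₂ h => halt 0 a₁ a₂ fun h0 => h h0.2) hs.1 hs.2.le
end
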